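/- For every m ≥ 5, the reduced Gröbner basis G_m of the indeterminate translation ideal I_{𝒞(t)} with respect to the product monomial order < equals the union of its restrictions to all 5-element subsets of cameras: G_m = ∪_{σ ∈ ([m] choose 5)} G_{𝒞(t_{σ_1},…,t_{σ_5})}, where G_{𝒞(t_{σ_1},…,t_{σ_5})} is the reduced Gröbner basis of the IT ideal of the five cameras indexed by σ (with respect to the corresponding product order). -/

import Mathlib

open MvPolynomial

noncomputable section

abbrev Vec3 := Fin 3 → ℂ
abbrev Vec4 := Fin 4 → ℂ
abbrev Camera := Matrix (Fin 3) (Fin 4) ℂ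

/-- The polynomial ring `R = ℂ[ℓ_{i,j} : 1 ≤ i ≤ 3, 1 ≤ j ≤ m]`. -/
abbrev LineRing (m : ℕ) := MvPolynomial (Fin 3 × Fin m) ℂ

/-- `c` is (a representative of) the center of the camera `C`. -/
def IsCenter (C : Camera) (c : Vec4) : Prop := c ≠ 0 ∧ C.mulVec c = 0

/-- A camera arrangement: `m ≥ 2` cameras of rank 3 with pairwise distinct centers. -/
def IsCameraArrangement {m : ℕ} (𝒞 : Fin m → Camera) : Prop :=
  2 ≤ m ∧ (∀ i, (𝒞 i).rank = 3) ∧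
    ∀ i j : Fin m, i ≠ j → ¬ ∃ c : Vec4, IsCenter (𝒞 i) c ∧ IsCenter (𝒞 j) c

/-- The cameras indexed by `S` have collinear centers: all of their centers lie on a
common projective line in ℙ³, i.e. in a common linear subspace of dimension ≤ 2 of ℂ⁴. -/
def CollinearCenters {m : ℕ} (𝒞 : Fin m → Camera) (S : Set (Fin m)) : Prop :=
  ∃ W : Submodule ℂ Vec4, Module.finrank ℂ W ≤ 2 ∧
    ∀ i ∈ S, ∃ c : Vec4, IsCenter (𝒞 i) c ∧ c ∈ W

/-- No four camera centers are collinear. -/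
def NoFourCollinear {m : ℕ} (𝒞 : Fin m → Camera) : Prop :=
  ∀ S : Finset (Fin m), S.card = 4 → ¬ CollinearCenters 𝒞 ↑S

/-- The total degree of a monomial. -/
def monDeg {σ : Type*} (α : σ →₀ ℕ) : ℕ := α.sum fun _ e => e

/-- The graded reverse lexicographic (GRevLex) strict order on monomials, where the
variables are ordered by `idx` (larger `idx` = further right): `α < β` iff
`deg α < deg β`, or the degrees agree and the rightmost entry where `α` and `β`
differ is larger in `α` (i.e. the rightmost nonzero entry of `β − α` is negative). -/
def GrevlexLT {σ : Type*} (idx : σ → ℕ) (α β : σ →₀ ℕ) : Prop :=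
  monDeg α < monDeg β ∨
    (monDeg α = monDeg β ∧ ∃ s, β s < α s ∧ ∀ t, idx s < idx t → α t = β t)

/-- `α` is the leading monomial of `f` with respect to the strict monomial order `lt`. -/
def IsLeadMon {σ : Type*} (lt : (σ →₀ ℕ) → (σ →₀ ℕ) → Prop)
    (f : MvPolynomial σ ℂ) (α : σ →₀ ℕ) : Prop :=
  α ∈ f.support ∧ ∀ β ∈ f.support, β ≠ α → lt β α

/-- `G` is a (finite) Gröbner basis of `I` with respect to the monomial order `lt`:
`G ⊆ I` and the leading monomial of every nonzero `f ∈ I` is divisible by the leading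
monomial of some element of `G`.  (Divisibility of monomials is the pointwise order
on exponent vectors.) -/
def IsGB {σ : Type*} (lt : (σ →₀ ℕ) → (σ →₀ ℕ) → Prop)
    (I : Ideal (MvPolynomial σ ℂ)) (G : Set (MvPolynomial σ ℂ)) : Prop :=
  G.Finite ∧ G ⊆ (I : Set (MvPolynomial σ ℂ)) ∧
    ∀ f ∈ I, f ≠ 0 → ∃ g ∈ G, ∃ a b : σ →₀ ℕ,
      IsLeadMon lt g a ∧ IsLeadMon lt f b ∧ a ≤ b

/-- `G` is the reduced Gröbner basis of `I` w.r.t. `lt`: a Gröbner basis all of whose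
elements are monic and such that the leading monomial of an element of `G` divides no
monomial appearing in another element of `G`. -/
def IsReducedGB {σ : Type*} (lt : (σ →₀ ℕ) → (σ →₀ ℕ) → Prop)
    (I : Ideal (MvPolynomial σ ℂ)) (G : Set (MvPolynomial σ ℂ)) : Prop :=
  IsGB lt I G ∧
    (∀ g ∈ G, ∃ a, IsLeadMon lt g a ∧ MvPolynomial.coeff a g = 1) ∧
    ∀ g ∈ G, ∀ g' ∈ G, g ≠ g' → ∀ a, IsLeadMon lt g a →
      ∀ b ∈ (g' : MvPolynomial _ ℂ).support, ¬ a ≤ b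

/-- The GRevLex order on the monomials of `R = ℂ[ℓ_{1,1}, …, ℓ_{3,m}]`, the variables
`ℓ_{i,j}` being listed in the order `ℓ_{1,1}, …, ℓ_{1,m}, ℓ_{2,1}, …, ℓ_{3,m}`. -/
def grevlexL (m : ℕ) : ((Fin 3 × Fin m) →₀ ℕ) → ((Fin 3 × Fin m) →₀ ℕ) → Prop :=
  GrevlexLT (fun p => (p.1 : ℕ) * m + (p.2 : ℕ))

/-- The ring `ℂ[ℓ, t]` in the `3m` variables `ℓ_{i,j}` (left summand) and the `3m`
variables `t_{i,j}` (right summand). -/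
abbrev LTRing (m : ℕ) := MvPolynomial ((Fin 3 × Fin m) ⊕ (Fin 3 × Fin m)) ℂ

/-- The symbolic translational camera `C(t_j) = [I₃ | t_j]` with entries in `ℂ[ℓ, t]`. -/
def CtPoly (m : ℕ) (j : Fin m) : Matrix (Fin 3) (Fin 4) (LTRing m) :=
  Matrix.of fun (i : Fin 3) (r : Fin 4) =>
    if (r : ℕ) = (i : ℕ) then 1
    else if (r : ℕ) = 3 then MvPolynomial.X (Sum.inr (i, j)) else 0

/-- The 4×m matrix over `ℂ[ℓ, t]` whose `j`-th column is `C(t_j)ᵀ ℓ_j`. -/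
def ITmatrix (m : ℕ) : Matrix (Fin 4) (Fin m) (LTRing m) :=
  Matrix.of fun r j => ∑ i : Fin 3, CtPoly m j i r * MvPolynomial.X (Sum.inl (i, j))

/-- The indeterminate translation (IT) ideal of the cameras indexed by `S`: the ideal
generated by the 3×3 minors of the submatrix of `[C(t₁)ᵀℓ₁ ⋯ C(t_m)ᵀℓ_m]` with columns
in `S`.  For `S = univ` this is the IT ideal `I_{𝒞(t)}`. -/
def ITidealOn (m : ℕ) (S : Set (Fin m)) : Ideal (LTRing m) :=
  Ideal.span {p | ∃ (ri : Fin 3 → Fin 4) (ci : Fin 3 → Fin m),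
    Function.Injective ri ∧ Function.Injective ci ∧ (∀ k, ci k ∈ S) ∧
      p = ((ITmatrix m).submatrix ri ci).det}

/-- Projection of an exponent vector of `ℂ[ℓ, t]` to its `ℓ`-part. -/
def projL {m : ℕ} (α : ((Fin 3 × Fin m) ⊕ (Fin 3 × Fin m)) →₀ ℕ) : (Fin 3 × Fin m) →₀ ℕ :=
  (Finsupp.sumFinsuppEquivProdFinsupp α).1

/-- Projection of an exponent vector of `ℂ[ℓ, t]` to its `t`-part. -/
def projT {m : ℕ} (α : ((Fin 3 × Fin m) ⊕ (Fin 3 × Fin m)) →₀ ℕ) : (Fin 3 × Fin m) →₀ ℕ :=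
  (Finsupp.sumFinsuppEquivProdFinsupp α).2

/-- The product monomial order `<` on `ℂ[ℓ, t]`: the product of the GRevLex orders on
the subrings `ℂ[ℓ]` and `ℂ[t]`, i.e. `ℓ^{α₁}t^{β₁} < ℓ^{α₂}t^{β₂}` iff
`ℓ^{α₁} <_GRevLex ℓ^{α₂}`, or `α₁ = α₂` and `t^{β₁} <_GRevLex t^{β₂}`. -/
def prodOrderLT (m : ℕ) (α β : ((Fin 3 × Fin m) ⊕ (Fin 3 × Fin m)) →₀ ℕ) : Prop :=
  grevlexL m (projL α) (projL β) ∨ (projL α = projL β ∧ grevlexL m (projT α) (projT β))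

/-! ### Monomial orders -/

section Orders

variable {σ : Type*}

/-- The two properties of a monomial order that are needed to compare reduced Gröbner bases. -/
structure IsOrderLike (lt : (σ →₀ ℕ) → (σ →₀ ℕ) → Prop) : Prop where
  asymm : ∀ a b, lt a b → ¬ lt b a
  not_lt_of_le : ∀ a c, a ≤ c → ¬ lt c a

theorem monDeg_add (a b : σ →₀ ℕ) : monDeg (a + b) = monDeg a + monDeg b :=
  Finsupp.sum_add_index' (fun _ => rfl) (fun _ _ _ => rfl)

theorem monDeg_single (s : σ) (n : ℕ) : monDeg (Finsupp.single s n) = n := by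
  simp [monDeg, Finsupp.sum_single_index]

theorem monDeg_mono {a b : σ →₀ ℕ} (h : a ≤ b) : monDeg a ≤ monDeg b := by
  obtain ⟨c, rfl⟩ := exists_add_of_le h
  rw [monDeg_add]; omega

theorem monDeg_eq_sum [Fintype σ] (a : σ →₀ ℕ) : monDeg a = ∑ s, a s :=
  Finsupp.sum_fintype _ _ (fun _ => rfl)

theorem eq_of_le_of_monDeg_eq {a b : σ →₀ ℕ} (h : a ≤ b) (hd : monDeg a = monDeg b) : a = b := by
  obtain ⟨c, rfl⟩ := exists_add_of_le h
  rw [monDeg_add] at hd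
  have hc : monDeg c = 0 := by omega
  have : c = 0 := by
    ext s
    have := monDeg_mono (Finsupp.single_le_iff.2 (le_refl (c s)))
    rw [monDeg_single] at this
    simp only [Finsupp.coe_zero, Pi.zero_apply]; omega
  simp [this]

theorem grevlexLT_isOrderLike {idx : σ → ℕ} (hidx : Function.Injective idx) :
    IsOrderLike (GrevlexLT idx) where
  asymm a b := by
    rintro (h | ⟨h, s, hs, hs'⟩) (h2 | ⟨h2, t, ht, ht'⟩)
    · omega
    · omega
    · omega
    · rcases lt_trichotomy (idx s) (idx t) with hst | hst | hst
      · have := hs' t hst; omega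
      · cases hidx hst; omega
      · have := ht' s hst; omega
  not_lt_of_le a c hac := by
    rintro (h | ⟨h, s, hs, -⟩)
    · have := monDeg_mono hac; omega
    · have := eq_of_le_of_monDeg_eq hac h.symm
      subst this; omega

/-- The index used by `grevlexL`. -/
def idxL (m : ℕ) (p : Fin 3 × Fin m) : ℕ := (p.1 : ℕ) * m + (p.2 : ℕ)

theorem idxL_lt_iff {m : ℕ} (p q : Fin 3 × Fin m) :
    idxL m p < idxL m q ↔ p.1 < q.1 ∨ p.1 = q.1 ∧ p.2 < q.2 := by
  obtain ⟨i, a⟩ := p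
  obtain ⟨j, b⟩ := q
  have ha := a.2
  have hb := b.2
  simp only [idxL, Fin.lt_def, Fin.ext_iff]
  rcases lt_trichotomy (i : ℕ) (j : ℕ) with h | h | h
  · have : ((i : ℕ) + 1) * m ≤ j * m := Nat.mul_le_mul_right _ h
    rw [add_mul] at this
    omega
  · rw [h]; omega
  · have : ((j : ℕ) + 1) * m ≤ i * m := Nat.mul_le_mul_right _ h
    rw [add_mul] at this
    omega

theorem idxL_injective (m : ℕ) : Function.Injective (idxL m) := by
  intro p q h
  have h1 := idxL_lt_iff p q
  have h2 := idxL_lt_iff q p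
  rw [h] at h1 h2
  simp only [lt_irrefl, false_iff, not_or, not_and, not_lt] at h1 h2
  have h3 : p.1 = q.1 := le_antisymm h2.1 h1.1
  exact Prod.ext h3 (le_antisymm (h2.2 h3.symm) (h1.2 h3))

theorem grevlexL_iff {m : ℕ} (α β : (Fin 3 × Fin m) →₀ ℕ) :
    grevlexL m α β ↔ GrevlexLT (idxL m) α β := Iff.rfl

theorem grevlexL_isOrderLike (m : ℕ) : IsOrderLike (grevlexL m) :=
  grevlexLT_isOrderLike (idxL_injective m)

@[simp] theorem projL_apply {m : ℕ} (α : ((Fin 3 × Fin m) ⊕ (Fin 3 × Fin m)) →₀ ℕ)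
    (p : Fin 3 × Fin m) : projL α p = α (Sum.inl p) := rfl

@[simp] theorem projT_apply {m : ℕ} (α : ((Fin 3 × Fin m) ⊕ (Fin 3 × Fin m)) →₀ ℕ)
    (p : Fin 3 × Fin m) : projT α p = α (Sum.inr p) := rfl

theorem prodOrderLT_isOrderLike (m : ℕ) : IsOrderLike (prodOrderLT m) where
  asymm a b := by
    have := grevlexL_isOrderLike m
    rintro (h | ⟨h, h'⟩) (k | ⟨k, k'⟩)
    · exact this.asymm _ _ h k
    · exact this.not_lt_of_le _ _ k.le h
    · exact this.not_lt_of_le _ _ h.le k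
    · exact this.asymm _ _ h' k'
  not_lt_of_le a c hac := by
    have := grevlexL_isOrderLike m
    rintro (h | ⟨h, h'⟩)
    · exact this.not_lt_of_le _ _ (fun p => hac (Sum.inl p)) h
    · exact this.not_lt_of_le _ _ (fun p => hac (Sum.inr p)) h'

variable {lt : (σ →₀ ℕ) → (σ →₀ ℕ) → Prop}

theorem IsOrderLike.irrefl (h : IsOrderLike lt) (a : σ →₀ ℕ) : ¬ lt a a :=
  h.not_lt_of_le a a le_rfl

theorem IsLeadMon.unique (h : IsOrderLike lt) {f : MvPolynomial σ ℂ} {a b : σ →₀ ℕ}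
    (ha : IsLeadMon lt f a) (hb : IsLeadMon lt f b) : a = b := by
  by_contra hab
  exact h.asymm _ _ (ha.2 b hb.1 (Ne.symm hab)) (hb.2 a ha.1 hab)

theorem IsLeadMon.ne_zero {f : MvPolynomial σ ℂ} {a : σ →₀ ℕ}
    (ha : IsLeadMon lt f a) : f ≠ 0 := by
  rintro rfl; simpa using ha.1

end Orders

/-! ### Restricting a polynomial to a set of variables -/

section Restrict

variable {σ : Type*}

open Classical in
/-- The substitution that sets all variables outside `T` equal to zero. -/
def restrictVars (T : Set σ) : MvPolynomial σ ℂ →ₐ[ℂ] MvPolynomial σ ℂ :=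
  aeval fun v => if v ∈ T then X v else 0

theorem restrictVars_X_of_mem {T : Set σ} {v : σ} (hv : v ∈ T) :
    restrictVars T (X v) = X v := by simp [restrictVars, hv]

theorem restrictVars_X_of_notMem {T : Set σ} {v : σ} (hv : v ∉ T) :
    restrictVars T (X v) = 0 := by simp [restrictVars, hv]

open Classical in
theorem restrictVars_monomial (T : Set σ) (a : σ →₀ ℕ) (c : ℂ) :
    restrictVars T (monomial a c) = if (↑a.support ⊆ T) then monomial a c else 0 := by
  rw [restrictVars, aeval_monomial]
  split_ifs with h
  · rw [monomial_eq]
    congr 1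
    refine Finset.prod_congr rfl fun v hv => ?_
    dsimp only
    rw [if_pos (h hv)]
  · obtain ⟨v, hv, hvT⟩ := Set.not_subset.1 h
    rw [Finsupp.prod, Finset.prod_eq_zero hv, mul_zero]
    rw [if_neg hvT, zero_pow (Finsupp.mem_support_iff.1 hv)]

open Classical in
theorem coeff_restrictVars (T : Set σ) (f : MvPolynomial σ ℂ) (a : σ →₀ ℕ) :
    coeff a (restrictVars T f) = if (↑a.support ⊆ T) then coeff a f else 0 := by
  induction f using MvPolynomial.induction_on' with
  | monomial b c =>
    rw [restrictVars_monomial]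
    split_ifs with h1 h2 h2
    · rfl
    · rw [coeff_monomial, if_neg]; rintro rfl; exact h2 h1
    · rw [coeff_monomial, if_neg, coeff_zero]; rintro rfl; exact h1 h2
    · simp
  | add p q hp hq => rw [map_add, coeff_add, hp, hq, coeff_add]; split_ifs <;> simp

end Restrict

/-! ### Comparing reduced Gröbner bases of an ideal and of a restriction of it -/

section Compare

variable {σ : Type*} {lt : (σ →₀ ℕ) → (σ →₀ ℕ) → Prop}

theorem IsReducedGB.eq_of_le {I : Ideal (MvPolynomial σ ℂ)}
    {G : Set (MvPolynomial σ ℂ)} (hG : IsReducedGB lt I G) {g g' : MvPolynomial σ ℂ}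
    (hg : g ∈ G) (hg' : g' ∈ G) {a b : σ →₀ ℕ} (ha : IsLeadMon lt g a)
    (hb : b ∈ g'.support) (hab : a ≤ b) : g = g' := by
  by_contra h
  exact hG.2.2 g hg g' hg' h a ha b hb hab

theorem IsReducedGB.coeff_lead (hlt : IsOrderLike lt) {I : Ideal (MvPolynomial σ ℂ)}
    {G : Set (MvPolynomial σ ℂ)} (hG : IsReducedGB lt I G) {g : MvPolynomial σ ℂ}
    (hg : g ∈ G) {a : σ →₀ ℕ} (ha : IsLeadMon lt g a) : coeff a g = 1 := by
  obtain ⟨b, hb, h1⟩ := hG.2.1 g hg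
  rwa [ha.unique hlt hb]

/-- A nonzero element of `I` whose support lies in that of some `g ∈ G` contains the leading
monomial of `g`. -/
theorem IsReducedGB.lead_le_of_support (hlt : IsOrderLike lt) {I : Ideal (MvPolynomial σ ℂ)}
    {G : Set (MvPolynomial σ ℂ)} (hG : IsReducedGB lt I G) {g f : MvPolynomial σ ℂ}
    (hg : g ∈ G) {a : σ →₀ ℕ} (ha : IsLeadMon lt g a) {c : σ →₀ ℕ}
    (hf : f ∈ I) (hc : IsLeadMon lt f c) (hcg : c ∈ g.support) : c = a := by
  by_contra hca
  obtain ⟨g', hg', a', b', ha', hb', hle⟩ := hG.1.2.2 f hf hc.ne_zero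
  rw [hb'.unique hlt hc] at hle
  cases hG.eq_of_le hg' hg ha' hcg hle
  rw [ha'.unique hlt ha] at hle
  exact hlt.not_lt_of_le _ _ hle (ha.2 c hcg hca)

theorem IsReducedGB.exists_lead {I : Ideal (MvPolynomial σ ℂ)}
    {G : Set (MvPolynomial σ ℂ)} (hG : IsReducedGB lt I G) {f : MvPolynomial σ ℂ}
    (hf : f ∈ I) (h0 : f ≠ 0) : ∃ b, IsLeadMon lt f b := by
  obtain ⟨g', hg', a', b', ha', hb', hle⟩ := hG.1.2.2 f hf h0
  exact ⟨b', hb'⟩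

theorem IsReducedGB.mem_of_lead_support (hlt : IsOrderLike lt)
    {I J : Ideal (MvPolynomial σ ℂ)} {G H : Set (MvPolynomial σ ℂ)}
    (hG : IsReducedGB lt I G) (hH : IsReducedGB lt J H) (hJI : J ≤ I) {T : Set σ}
    (hres : ∀ f ∈ I, restrictVars T f ∈ J) {g : MvPolynomial σ ℂ} (hg : g ∈ G)
    {a : σ →₀ ℕ} (ha : IsLeadMon lt g a) (haT : ↑a.support ⊆ T) : g ∈ H := by
  classical
  have hgI : g ∈ I := hG.1.2.1 hg
  have hgr : g - restrictVars T g = 0 := by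
    by_contra h0
    have hmem : g - restrictVars T g ∈ I := I.sub_mem hgI (hJI (hres g hgI))
    obtain ⟨c, hc⟩ := hG.exists_lead hmem h0
    have hcc : coeff c (g - restrictVars T g) ≠ 0 := mem_support_iff.1 hc.1
    rw [coeff_sub, coeff_restrictVars] at hcc
    have hcg : c ∈ g.support := by
      rw [mem_support_iff]; intro h; simp [h] at hcc
    have := hG.lead_le_of_support hlt hg ha hmem hc hcg
    subst this
    simp [haT] at hcc
  have hgJ : g ∈ J := by
    rw [sub_eq_zero.1 hgr]; exact hres g hgI
  obtain ⟨k, hk, a', b', ha', hb', hle⟩ := hH.1.2.2 g hgJ ha.ne_zero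
  rw [hb'.unique hlt ha] at hle
  have hkI : k ∈ I := hJI (hH.1.2.1 hk)
  have haa : a' = a := by
    obtain ⟨g', hg', a2, b2, ha2, hb2, hle2⟩ := hG.1.2.2 k hkI ha'.ne_zero
    rw [hb2.unique hlt ha'] at hle2
    cases hG.eq_of_le hg' hg ha2 ha.1 (hle2.trans hle)
    rw [ha2.unique hlt ha] at hle2
    exact le_antisymm hle hle2
  subst haa
  have hgk : g - k = 0 := by
    by_contra h0
    have hmem : g - k ∈ J := J.sub_mem hgJ (hH.1.2.1 hk)
    obtain ⟨c, hc⟩ := hH.exists_lead hmem h0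
    have hcc : coeff c (g - k) ≠ 0 := mem_support_iff.1 hc.1
    rw [coeff_sub] at hcc
    have hca : c ≠ a' := by
      rintro rfl
      rw [hG.coeff_lead hlt hg ha, hH.coeff_lead hlt hk ha'] at hcc
      simp at hcc
    by_cases hcg : c ∈ g.support
    · exact hca (hG.lead_le_of_support hlt hg ha (hJI hmem) hc hcg)
    · have hck : c ∈ k.support := by
        rw [mem_support_iff]; intro h
        rw [notMem_support_iff.1 hcg, h] at hcc
        simp at hcc
      exact hca (hH.lead_le_of_support hlt hk ha' hmem hc hck)
  rwa [sub_eq_zero.1 hgk]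

theorem IsReducedGB.lead_support_subset (hlt : IsOrderLike lt)
    {J : Ideal (MvPolynomial σ ℂ)} {H : Set (MvPolynomial σ ℂ)}
    (hH : IsReducedGB lt J H) {T : Set σ}
    (hder : ∀ v ∉ T, ∀ f ∈ J, pderiv v f ∈ J) {g : MvPolynomial σ ℂ} (hg : g ∈ H)
    {a : σ →₀ ℕ} (ha : IsLeadMon lt g a) : ↑a.support ⊆ T := by
  classical
  intro v hv
  by_contra hvT
  have hav : a v ≠ 0 := Finsupp.mem_support_iff.1 hv
  have hmem := hder v hvT g (hH.1.2.1 hg)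
  have hco : ∀ b, coeff b (pderiv v g) = coeff (b + Finsupp.single v 1) g * (b v + 1) :=
    fun b => coeff_pderiv g b
  have h0 : pderiv v g ≠ 0 := by
    intro h
    have := hco (a - Finsupp.single v 1)
    rw [h, coeff_zero, tsub_add_cancel_of_le] at this
    · rw [eq_comm, mul_eq_zero] at this
      rcases this with h | h
      · exact mem_support_iff.1 ha.1 h
      · exact Nat.cast_add_one_ne_zero _ h
    · rw [Finsupp.single_le_iff]; omega
  obtain ⟨k, hk, a', b', ha', hb', hle⟩ := hH.1.2.2 _ hmem h0
  have hb : b' + Finsupp.single v 1 ∈ g.support := by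
    rw [mem_support_iff]
    intro h
    have := mem_support_iff.1 hb'.1
    rw [hco, h, zero_mul] at this
    exact this rfl
  have hle2 : b' ≤ b' + Finsupp.single v 1 := le_self_add
  cases hH.eq_of_le hk hg ha' hb (hle.trans hle2)
  rw [ha'.unique hlt ha] at hle
  by_cases h : b' + Finsupp.single v 1 = a
  · have := hle v
    rw [← h] at this
    simp at this
  · exact hlt.not_lt_of_le _ _ (hle.trans hle2) (ha.2 _ hb h)

theorem IsReducedGB.mem_of_mem_restrict (hlt : IsOrderLike lt)
    {I J : Ideal (MvPolynomial σ ℂ)} {G H : Set (MvPolynomial σ ℂ)}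
    (hG : IsReducedGB lt I G) (hH : IsReducedGB lt J H) (hJI : J ≤ I) {T : Set σ}
    (hres : ∀ f ∈ I, restrictVars T f ∈ J)
    (hder : ∀ v ∉ T, ∀ f ∈ J, pderiv v f ∈ J) {g : MvPolynomial σ ℂ} (hg : g ∈ H) :
    g ∈ G := by
  classical
  obtain ⟨a, ha, -⟩ := hH.2.1 g hg
  have haT := hH.lead_support_subset hlt hder hg ha
  obtain ⟨g', hg', a', b', ha', hb', hle⟩ := hG.1.2.2 g (hJI (hH.1.2.1 hg)) ha.ne_zero
  rw [hb'.unique hlt ha] at hle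
  have haT' : ↑a'.support ⊆ T := fun v hv => haT (Finsupp.support_mono hle hv)
  have hgH := hG.mem_of_lead_support hlt hH hJI hres hg' ha' haT'
  rwa [← hH.eq_of_le hgH hg ha' ha.1 hle]

end Compare

/-! ### Restricting the IT ideal to a set of cameras -/

section ITIdeal

variable {m : ℕ}

/-- The camera to which a variable belongs. -/
def varCol : (Fin 3 × Fin m) ⊕ (Fin 3 × Fin m) → Fin m := Sum.elim Prod.snd Prod.snd

theorem ITmatrix_zero (j : Fin m) : ITmatrix m 0 j = X (Sum.inl (0, j)) := by
  simp [ITmatrix, CtPoly, Fin.sum_univ_three]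

theorem ITmatrix_one (j : Fin m) : ITmatrix m 1 j = X (Sum.inl (1, j)) := by
  simp [ITmatrix, CtPoly, Fin.sum_univ_three]

theorem ITmatrix_two (j : Fin m) : ITmatrix m 2 j = X (Sum.inl (2, j)) := by
  simp [ITmatrix, CtPoly, Fin.sum_univ_three]

theorem ITmatrix_three (j : Fin m) : ITmatrix m 3 j =
    X (Sum.inr (0, j)) * X (Sum.inl (0, j)) + X (Sum.inr (1, j)) * X (Sum.inl (1, j)) +
      X (Sum.inr (2, j)) * X (Sum.inl (2, j)) := by
  simp [ITmatrix, CtPoly, Fin.sum_univ_three]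

theorem ITidealOn_mono {S T : Set (Fin m)} (h : S ⊆ T) : ITidealOn m S ≤ ITidealOn m T := by
  refine Ideal.span_mono ?_
  rintro p ⟨ri, ci, hri, hci, hS, rfl⟩
  exact ⟨ri, ci, hri, hci, fun k => h (hS k), rfl⟩

theorem restrictVars_ITmatrix_of_mem {S : Set (Fin m)} {j : Fin m} (hj : j ∈ S) (i : Fin 4) :
    restrictVars (varCol ⁻¹' S) (ITmatrix m i j) = ITmatrix m i j := by
  have hl : ∀ i, restrictVars (varCol ⁻¹' S) (X (Sum.inl (i, j))) = X (Sum.inl (i, j)) :=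
    fun i => restrictVars_X_of_mem (by simpa [varCol] using hj)
  have hr : ∀ i, restrictVars (varCol ⁻¹' S) (X (Sum.inr (i, j))) = X (Sum.inr (i, j)) :=
    fun i => restrictVars_X_of_mem (by simpa [varCol] using hj)
  fin_cases i <;>
  simp [ITmatrix_zero, ITmatrix_one, ITmatrix_two, ITmatrix_three, hl, hr]

theorem restrictVars_ITmatrix_of_notMem {S : Set (Fin m)} {j : Fin m} (hj : j ∉ S) (i : Fin 4) :
    restrictVars (varCol ⁻¹' S) (ITmatrix m i j) = 0 := by
  have hl : ∀ i, restrictVars (varCol ⁻¹' S) (X (Sum.inl (i, j))) = 0 :=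
    fun i => restrictVars_X_of_notMem (by simpa [varCol] using hj)
  fin_cases i <;>
  simp [ITmatrix_zero, ITmatrix_one, ITmatrix_two, ITmatrix_three, hl]

theorem restrictVars_mem_ITidealOn (S : Set (Fin m)) {f : LTRing m}
    (hf : f ∈ ITidealOn m Set.univ) : restrictVars (varCol ⁻¹' S) f ∈ ITidealOn m S := by
  suffices ITidealOn m Set.univ ≤ (ITidealOn m S).comap (restrictVars (varCol ⁻¹' S)) from this hf
  refine Ideal.span_le.2 ?_
  rintro p ⟨ri, ci, hri, hci, -, rfl⟩
  simp only [SetLike.mem_coe, Ideal.mem_comap]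
  rw [AlgHom.map_det]
  by_cases h : ∀ k, ci k ∈ S
  · refine Ideal.subset_span ⟨ri, ci, hri, hci, h, ?_⟩
    congr 1
    refine Matrix.ext fun i k => ?_
    exact restrictVars_ITmatrix_of_mem (h k) _
  · push Not at h
    obtain ⟨k, hk⟩ := h
    rw [Matrix.det_eq_zero_of_column_eq_zero k]
    · exact zero_mem _
    · exact fun i => restrictVars_ITmatrix_of_notMem hk _

theorem pderiv_ITmatrix {v : (Fin 3 × Fin m) ⊕ (Fin 3 × Fin m)} {j : Fin m} (hv : varCol v ≠ j)
    (i : Fin 4) : pderiv v (ITmatrix m i j) = 0 := by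
  have hl : ∀ i, pderiv (R := ℂ) v (X (Sum.inl (i, j))) = 0 :=
    fun i => pderiv_X_of_ne (by rintro rfl; exact hv rfl)
  have hr : ∀ i, pderiv (R := ℂ) v (X (Sum.inr (i, j))) = 0 :=
    fun i => pderiv_X_of_ne (by rintro rfl; exact hv rfl)
  fin_cases i <;>
  simp [ITmatrix_zero, ITmatrix_one, ITmatrix_two, ITmatrix_three, hl, hr]

theorem pderiv_mem_ITidealOn {S : Set (Fin m)} {v : (Fin 3 × Fin m) ⊕ (Fin 3 × Fin m)}
    (hv : varCol v ∉ S) {f : LTRing m} (hf : f ∈ ITidealOn m S) :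
    pderiv v f ∈ ITidealOn m S := by
  refine Submodule.span_induction ?_ ?_ ?_ ?_ hf
  · rintro p ⟨ri, ci, hri, hci, hS, rfl⟩
    have h : ∀ i k, pderiv v (ITmatrix m (ri i) (ci k)) = 0 := fun i k =>
      pderiv_ITmatrix (by intro h; exact hv (h ▸ hS k)) _
    convert zero_mem (ITidealOn m S)
    simp [Matrix.det_fin_three, h]
  · simp
  · intro x y _ _ hx hy
    rw [map_add]; exact add_mem hx hy
  · intro r x hx hx'
    rw [smul_eq_mul, Derivation.leibniz, smul_eq_mul, smul_eq_mul]
    exact add_mem (Ideal.mul_mem_left _ _ hx') (Ideal.mul_mem_right _ _ hx)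

/-- If every leading monomial of the IT ideal is divisible by one that only involves five
cameras, then the reduced Gröbner basis is the union of those of the 5-camera ideals. -/
theorem reducedGB_eq_iUnion_of_exists_le
    (hmain : ∀ f ∈ ITidealOn m Set.univ, ∀ b, IsLeadMon (prodOrderLT m) f b →
      ∃ h ∈ ITidealOn m Set.univ, ∃ a, IsLeadMon (prodOrderLT m) h a ∧ a ≤ b ∧
        ∃ σ : Finset (Fin m), σ.card = 5 ∧ ↑a.support ⊆ varCol ⁻¹' (σ : Set (Fin m)))
    (G : Set (LTRing m))
    (hG : IsReducedGB (prodOrderLT m) (ITidealOn m Set.univ) G)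
    (𝒢 : Finset (Fin m) → Set (LTRing m))
    (h𝒢 : ∀ σ : Finset (Fin m), σ.card = 5 →
      IsReducedGB (prodOrderLT m) (ITidealOn m ↑σ) (𝒢 σ)) :
    G = ⋃ (σ : Finset (Fin m)) (_ : σ.card = 5), 𝒢 σ := by
  have hlt := prodOrderLT_isOrderLike m
  ext g
  simp only [Set.mem_iUnion, exists_prop]
  constructor
  · intro hg
    obtain ⟨b, hb, -⟩ := hG.2.1 g hg
    obtain ⟨h, hh, a, ha, hab, σ, hσ, hs⟩ := hmain g (hG.1.2.1 hg) b hb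
    refine ⟨σ, hσ, ?_⟩
    obtain ⟨g', hg', a', b', ha', hb', hle⟩ := hG.1.2.2 h hh ha.ne_zero
    rw [hb'.unique hlt ha] at hle
    cases hG.eq_of_le hg' hg ha' hb.1 (hle.trans hab)
    exact hG.mem_of_lead_support hlt (h𝒢 σ hσ) (ITidealOn_mono (Set.subset_univ _))
      (fun f hf => restrictVars_mem_ITidealOn _ hf) hg ha'
      (fun v hv => hs (Finsupp.support_mono hle hv))
  · rintro ⟨σ, hσ, hg⟩
    exact hG.mem_of_mem_restrict hlt (h𝒢 σ hσ) (ITidealOn_mono (Set.subset_univ _))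
      (fun f hf => restrictVars_mem_ITidealOn _ hf)
      (fun v hv f hf => pderiv_mem_ITidealOn hv hf) hg

end ITIdeal

/-! ### Producing elements of the IT ideal with prescribed leading monomial -/

section Leading

variable {m : ℕ}

/-- `f` is homogeneous of degree `n` in the line variables. -/
def LHomogeneous (f : LTRing m) (n : ℕ) : Prop :=
  IsWeightedHomogeneous (Sum.elim (fun _ => 1) (fun _ => 0) :
    (Fin 3 × Fin m) ⊕ (Fin 3 × Fin m) → ℕ) f n

theorem LHomogeneous.mul {f g : LTRing m} {k n : ℕ} (hf : LHomogeneous f k)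
    (hg : LHomogeneous g n) : LHomogeneous (f * g) (k + n) :=
  IsWeightedHomogeneous.mul hf hg

theorem LHomogeneous.add {f g : LTRing m} {n : ℕ} (hf : LHomogeneous f n)
    (hg : LHomogeneous g n) : LHomogeneous (f + g) n :=
  IsWeightedHomogeneous.add hf hg

theorem lHomogeneous_C (c : ℂ) : LHomogeneous (C c : LTRing m) 0 :=
  isWeightedHomogeneous_C _ c

theorem LHomogeneous.sub {f g : LTRing m} {n : ℕ} (hf : LHomogeneous f n)
    (hg : LHomogeneous g n) : LHomogeneous (f - g) n := by
  have h := (lHomogeneous_C (m := m) (-1)).mul hg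
  rw [zero_add] at h
  convert hf.add h using 1
  simp [sub_eq_add_neg]

theorem lHomogeneous_inl (p : Fin 3 × Fin m) : LHomogeneous (X (Sum.inl p) : LTRing m) 1 :=
  isWeightedHomogeneous_X _ _ _

theorem lHomogeneous_inr (p : Fin 3 × Fin m) : LHomogeneous (X (Sum.inr p) : LTRing m) 0 :=
  isWeightedHomogeneous_X _ _ _

theorem LHomogeneous.monDeg_projL {f : LTRing m} {n : ℕ} (hf : LHomogeneous f n)
    {κ : (Fin 3 × Fin m) ⊕ (Fin 3 × Fin m) →₀ ℕ} (hκ : κ ∈ f.support) :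
    monDeg (projL κ) = n := by
  rw [← hf (mem_support_iff.1 hκ), Finsupp.weight_apply, monDeg_eq_sum,
    Finsupp.sum_fintype _ _ (by simp), Fintype.sum_sum_type]
  simp

theorem lHomogeneous_ITmatrix (i : Fin 4) (j : Fin m) : LHomogeneous (ITmatrix m i j) 1 := by
  have h := fun i => (lHomogeneous_inr (i, j)).mul (lHomogeneous_inl (i, j))
  fin_cases i
  · simpa [ITmatrix_zero] using lHomogeneous_inl (0, j)
  · simpa [ITmatrix_one] using lHomogeneous_inl (1, j)
  · simpa [ITmatrix_two] using lHomogeneous_inl (2, j)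
  · simpa [ITmatrix_three] using ((h 0).add (h 1)).add (h 2)

/-- The 3×3 minors of the IT matrix. -/
def minor (ri : Fin 3 → Fin 4) (ci : Fin 3 → Fin m) : LTRing m :=
  ((ITmatrix m).submatrix ri ci).det

theorem lHomogeneous_minor (ri : Fin 3 → Fin 4) (ci : Fin 3 → Fin m) :
    LHomogeneous (minor ri ci) 3 := by
  have h := fun i j => lHomogeneous_ITmatrix (m := m) (ri i) (ci j)
  have h3 := fun i j i' j' i'' j'' => ((h i j).mul (h i' j')).mul (h i'' j'')
  rw [minor, Matrix.det_fin_three]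
  exact (((((h3 _ _ _ _ _ _).sub (h3 _ _ _ _ _ _)).sub (h3 _ _ _ _ _ _)).add
    (h3 _ _ _ _ _ _)).add (h3 _ _ _ _ _ _)).sub (h3 _ _ _ _ _ _)

theorem minor_mem {ri : Fin 3 → Fin 4} {ci : Fin 3 → Fin m} (hri : Function.Injective ri)
    (hci : Function.Injective ci) : minor ri ci ∈ ITidealOn m Set.univ :=
  Ideal.subset_span ⟨ri, ci, hri, hci, fun _ => trivial, rfl⟩

theorem injective_vec3 {α : Type*} {a b c : α} (hab : a ≠ b) (hac : a ≠ c) (hbc : b ≠ c) :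
    Function.Injective ![a, b, c] := by
  intro i j h
  fin_cases i <;> fin_cases j <;> simp_all

/-- The exponent vector of a product of variables. -/
def listExp {σ : Type*} (A : List σ) : σ →₀ ℕ := (A.map fun p => Finsupp.single p 1).sum

theorem listExp_apply {σ : Type*} [BEq σ] [LawfulBEq σ] (A : List σ) (p : σ) :
    listExp A p = A.count p := by
  classical
  induction A with
  | nil => simp [listExp]
  | cons q A ih =>
    simp only [listExp, List.map_cons, List.sum_cons, Finsupp.add_apply] at ih ⊢
    rw [ih, List.count_cons, Finsupp.single_apply]
    simp [add_comm, beq_iff_eq]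

theorem listExp_append {σ : Type*} (A B : List σ) :
    listExp (A ++ B) = listExp A + listExp B := by
  simp [listExp]

theorem listExp_eq_zero {σ : Type*} {A : List σ} {p : σ} (hp : p ∉ A) : listExp A p = 0 := by
  classical
  induction A with
  | nil => simp [listExp]
  | cons q A ih =>
    simp only [listExp, List.map_cons, List.sum_cons, Finsupp.add_apply] at ih ⊢
    rw [ih (fun h => hp (by simp [h])), Finsupp.single_apply, if_neg]
    rintro rfl; simp at hp

theorem listExp_map_apply {σ τ : Type*} {f : σ → τ} (hf : Function.Injective f) (A : List σ)
    (p : σ) : listExp (A.map f) (f p) = listExp A p := by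
  classical
  induction A with
  | nil => simp [listExp]
  | cons q A ih =>
    simp only [listExp, List.map_cons, List.sum_cons, Finsupp.add_apply] at ih ⊢
    rw [ih, Finsupp.single_apply, Finsupp.single_apply, hf.eq_iff]

theorem monDeg_listExp {σ : Type*} (A : List σ) : monDeg (listExp A) = A.length := by
  induction A with
  | nil => simp [listExp, monDeg]
  | cons q A ih =>
    simp only [listExp, List.map_cons, List.sum_cons] at ih ⊢
    rw [monDeg_add, ih, monDeg_single, List.length_cons, add_comm]

theorem prod_X_eq_monomial {σ : Type*} (A : List σ) :
    (A.map (fun p => (X p : MvPolynomial σ ℂ))).prod = monomial (listExp A) 1 := by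
  induction A with
  | nil => simp [listExp]
  | cons q A ih =>
    simp only [List.map_cons, List.prod_cons] at ih ⊢
    rw [ih]
    simp [listExp, X, monomial_mul]

/-- The product of line variables. -/
def lmon (A : List (Fin 3 × Fin m)) : LTRing m := (A.map fun p => X (Sum.inl p)).prod

/-- The product of translation variables. -/
def tmon (A : List (Fin 3 × Fin m)) : LTRing m := (A.map fun p => X (Sum.inr p)).prod

/-- The exponent of `tmon T * lmon A`. -/
def prodExp (A T : List (Fin 3 × Fin m)) : (Fin 3 × Fin m) ⊕ (Fin 3 × Fin m) →₀ ℕ :=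
  listExp (T.map Sum.inr ++ A.map Sum.inl)

theorem tmon_mul_lmon (A T : List (Fin 3 × Fin m)) :
    tmon T * lmon A = monomial (prodExp A T) 1 := by
  rw [prodExp, ← prod_X_eq_monomial]
  simp [tmon, lmon, Function.comp_def]

theorem projL_prodExp (A T : List (Fin 3 × Fin m)) : projL (prodExp A T) = listExp A := by
  ext p
  rw [projL_apply, prodExp, listExp_append, Finsupp.add_apply, listExp_eq_zero (by simp),
    listExp_map_apply Sum.inl_injective, zero_add]

theorem projT_prodExp (A T : List (Fin 3 × Fin m)) : projT (prodExp A T) = listExp T := by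
  ext p
  rw [projT_apply, prodExp, listExp_append, Finsupp.add_apply,
    listExp_map_apply Sum.inr_injective, listExp_eq_zero (A := A.map Sum.inl) (by simp), add_zero]

/-- A sufficient condition for every multiple of the monomial given by `B` of the same degree as
the (squarefree) monomial given by `A` to be smaller than the latter. -/
def ListSmaller (B A : List (Fin 3 × Fin m)) : Prop :=
  ∃ s ∈ B, (s ∈ A → 2 ≤ B.count s) ∧ ∀ p ∈ A, idxL m s < idxL m p → p ∈ B

theorem grevlexL_of_listSmaller {A B : List (Fin 3 × Fin m)} (hA : A.Nodup)
    (h : ListSmaller B A) {κ : Fin 3 × Fin m →₀ ℕ} (hB : listExp B ≤ κ)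
    (hd : monDeg κ = A.length) : grevlexL m κ (listExp A) := by
  classical
  obtain ⟨s, hsB, hsA, hp⟩ := h
  have hB' : ∀ p, B.count p ≤ κ p := fun p => by
    simpa [listExp_apply] using hB p
  have key : ∀ p, p = s ∨ idxL m s < idxL m p →
      listExp A p ≤ κ p ∧ (p = s → listExp A p < κ p) := by
    intro p hps
    rw [listExp_apply]
    have hc := List.nodup_iff_count_le_one.1 hA p
    rcases hps with rfl | hps
    · have h1 : 1 ≤ B.count p := List.one_le_count_iff.2 hsB
      have := hB' p
      by_cases hpA : p ∈ A
      · have := hsA hpA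
        omega
      · rw [List.count_eq_zero.2 hpA]; omega
    · have hne : p ≠ s := by rintro rfl; exact lt_irrefl _ hps
      refine ⟨?_, fun h => absurd h hne⟩
      by_cases hpA : p ∈ A
      · have h1 : 1 ≤ B.count p := List.one_le_count_iff.2 (hp p hpA hps)
        have := hB' p
        omega
      · rw [List.count_eq_zero.2 hpA]; omega
  rw [grevlexL_iff]
  refine Or.inr ⟨by rw [monDeg_listExp, hd], ?_⟩
  -- the rightmost index where the two vectors differ
  obtain ⟨r, hr, hmax⟩ := Finset.exists_max_image
    (Finset.univ.filter fun p => (p = s ∨ idxL m s < idxL m p) ∧ listExp A p < κ p) (idxL m)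
    ⟨s, by simpa using (key s (Or.inl rfl)).2 rfl⟩
  simp only [Finset.mem_filter, Finset.mem_univ, true_and] at hr hmax
  refine ⟨r, hr.2, fun p hp' => ?_⟩
  have hps : p = s ∨ idxL m s < idxL m p := by
    rcases hr.1 with rfl | h
    · exact Or.inr hp'
    · exact Or.inr (h.trans hp')
  have h1 := (key p hps).1
  by_contra hne
  have := hmax p ⟨hps, by omega⟩
  omega

/-- Some leading monomial of the IT ideal dividing `b` involves at most five cameras. -/
def FiveDivides (b : (Fin 3 × Fin m) ⊕ (Fin 3 × Fin m) →₀ ℕ) : Prop :=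
  ∃ h ∈ ITidealOn m Set.univ, ∃ a, IsLeadMon (prodOrderLT m) h a ∧ a ≤ b ∧
    ∃ σ : Finset (Fin m), σ.card = 5 ∧ ↑a.support ⊆ varCol ⁻¹' (σ : Set (Fin m))

theorem isLeadMon_of_congr {h : LTRing m} {A T : List (Fin 3 × Fin m)} (hA : A.Nodup)
    (hT : T.Nodup) (hh : LHomogeneous h A.length) {c : ℂ} (hc : c ≠ 0)
    (Rs : List (ℂ × List (Fin 3 × Fin m)))
    (hRs : ∀ r ∈ Rs, ListSmaller r.2 T ∧ r.2.length = T.length)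
    (Bs : List (List (Fin 3 × Fin m))) (hBs : ∀ B ∈ Bs, ListSmaller B A)
    (hcongr : ∀ (S : Type) (_ : CommRing S) (ψ : LTRing m →+* S),
      (∀ B ∈ Bs, ψ (lmon B) = 0) →
      ψ h = ψ (C c * tmon T * lmon A + (Rs.map fun r => C r.1 * tmon r.2 * lmon A).sum)) :
    IsLeadMon (prodOrderLT m) h (prodExp A T) := by
  classical
  have hlt := prodOrderLT_isOrderLike m
  set R : LTRing m := (Rs.map fun r => C r.1 * tmon r.2 * lmon A).sum with hR
  have hterm : ∀ (c : ℂ) (T' : List (Fin 3 × Fin m)),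
      C c * tmon T' * lmon A = monomial (prodExp A T') c := by
    intro c T'
    rw [mul_assoc, tmon_mul_lmon, C_mul_monomial, mul_one]
  have hRsupp : ∀ κ ∈ R.support, ∃ r ∈ Rs, κ = prodExp A r.2 := by
    rw [hR]
    clear_value R
    clear hR hcongr hRs
    induction Rs with
    | nil => simp
    | cons r Rs ih =>
      intro κ hκ
      rw [List.map_cons, List.sum_cons, hterm] at hκ
      rcases Finset.mem_union.1 (support_add hκ) with h | h
      · exact ⟨r, by simp, Finset.mem_singleton.1 (support_monomial_subset h)⟩
      · obtain ⟨r', hr', h'⟩ := ih κ h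
        exact ⟨r', by simp [hr'], h'⟩
  have hRlt : ∀ κ ∈ R.support, prodOrderLT m κ (prodExp A T) := by
    intro κ hκ
    obtain ⟨r, hr, rfl⟩ := hRsupp κ hκ
    refine Or.inr ⟨by simp only [projL_prodExp], ?_⟩
    rw [projT_prodExp, projT_prodExp]
    exact grevlexL_of_listSmaller hT (hRs r hr).1 le_rfl
      (by rw [monDeg_listExp, (hRs r hr).2])
  set J : Ideal (LTRing m) := Ideal.span ((fun s => monomial s (1 : ℂ)) ''
    {s | ∃ B ∈ Bs, s = listExp (B.map Sum.inl)}) with hJ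
  have hmem : h - (monomial (prodExp A T) c + R) ∈ J := by
    rw [← Ideal.Quotient.eq, hcongr _ _ (Ideal.Quotient.mk J), hterm]
    intro B hB
    rw [Ideal.Quotient.eq_zero_iff_mem]
    refine Ideal.subset_span ⟨listExp (B.map Sum.inl), ⟨B, hB, rfl⟩, ?_⟩
    dsimp only
    rw [← prod_X_eq_monomial]
    simp [lmon, Function.comp_def]
  rw [hJ, mem_ideal_span_monomial_image] at hmem
  set D := h - (monomial (prodExp A T) c + R) with hD
  have hDlt : ∀ κ ∈ D.support, prodOrderLT m κ (prodExp A T) := by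
    intro κ hκ
    obtain ⟨_, ⟨B, hB, rfl⟩, hle⟩ := hmem κ hκ
    refine Or.inl ?_
    rw [projL_prodExp]
    have hdeg : monDeg (projL κ) = A.length := by
      have h1 := mem_support_iff.1 hκ
      rw [hD, coeff_sub, coeff_add] at h1
      by_cases h2 : κ ∈ h.support
      · exact hh.monDeg_projL h2
      · by_cases h3 : κ ∈ R.support
        · obtain ⟨r, hr, rfl⟩ := hRsupp κ h3
          rw [projL_prodExp, monDeg_listExp]
        · rw [notMem_support_iff.1 h2, notMem_support_iff.1 h3, coeff_monomial] at h1
          split_ifs at h1 with h4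
          · rw [← h4, projL_prodExp, monDeg_listExp]
          · simp at h1
    refine grevlexL_of_listSmaller hA (hBs B hB) (fun p => ?_) hdeg
    have := hle (Sum.inl p)
    rwa [listExp_map_apply Sum.inl_injective] at this
  have hsum : h = D + (monomial (prodExp A T) c + R) := by rw [hD]; ring
  have hnot : ∀ f : LTRing m, (∀ κ ∈ f.support, prodOrderLT m κ (prodExp A T)) →
      coeff (prodExp A T) f = 0 := by
    intro f hf
    by_contra h0
    exact hlt.irrefl _ (hf _ (mem_support_iff.2 h0))
  constructor
  · rw [mem_support_iff, hsum, coeff_add, coeff_add, hnot D hDlt, hnot R hRlt]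
    simpa using hc
  · intro κ hκ hne
    rw [hsum] at hκ
    rcases Finset.mem_union.1 (support_add hκ) with h1 | h1
    · exact hDlt κ h1
    · rcases Finset.mem_union.1 (support_add h1) with h2 | h2
      · exact absurd (Finset.mem_singleton.1 (support_monomial_subset h2)) hne
      · exact hRlt κ h2

theorem fiveDivides_of_congr (hm : 5 ≤ m) {h : LTRing m} (hI : h ∈ ITidealOn m Set.univ)
    {A T : List (Fin 3 × Fin m)} (hA : A.Nodup)
    (hT : T.Nodup) (hh : LHomogeneous h A.length) {c : ℂ} (hc : c ≠ 0)
    (Rs : List (ℂ × List (Fin 3 × Fin m)))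
    (hRs : ∀ r ∈ Rs, ListSmaller r.2 T ∧ r.2.length = T.length)
    (Bs : List (List (Fin 3 × Fin m))) (hBs : ∀ B ∈ Bs, ListSmaller B A)
    (hcongr : ∀ (S : Type) (_ : CommRing S) (ψ : LTRing m →+* S),
      (∀ B ∈ Bs, ψ (lmon B) = 0) →
      ψ h = ψ (C c * tmon T * lmon A + (Rs.map fun r => C r.1 * tmon r.2 * lmon A).sum))
    (hlen : A.length ≤ 5) (hTA : ∀ p ∈ T, ∃ q ∈ A, p.2 = q.2)
    {b : (Fin 3 × Fin m) ⊕ (Fin 3 × Fin m) →₀ ℕ}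
    (hAb : ∀ p ∈ A, b (Sum.inl p) ≠ 0) (hTb : ∀ p ∈ T, b (Sum.inr p) ≠ 0) :
    FiveDivides b := by
  classical
  refine ⟨h, hI, prodExp A T, isLeadMon_of_congr hA hT hh hc Rs hRs Bs hBs hcongr, ?_, ?_⟩
  · have hle : ∀ (L : List (Fin 3 × Fin m)), L.Nodup → ∀ f : Fin 3 × Fin m → ℕ,
        (∀ p ∈ L, f p ≠ 0) → ∀ p, listExp L p ≤ f p := by
      intro L hL f hf p
      rw [listExp_apply]
      by_cases hp : p ∈ L
      · have := hf p hp
        have := List.nodup_iff_count_le_one.1 hL p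
        omega
      · rw [List.count_eq_zero.2 hp]; omega
    rintro (p | p)
    · rw [← projL_apply, projL_prodExp]
      exact hle A hA (fun p => b (Sum.inl p)) hAb p
    · rw [← projT_apply, projT_prodExp]
      exact hle T hT (fun p => b (Sum.inr p)) hTb p
  · obtain ⟨σ, hσ, -, hcard⟩ := Finset.exists_subsuperset_card_eq
      (s := (A.map Prod.snd).toFinset) (t := Finset.univ) (n := 5) (Finset.subset_univ _)
      ((List.toFinset_card_le _).trans (by simpa using hlen)) (by simpa using hm)
    refine ⟨σ, hcard, fun v hv => ?_⟩
    have hv' : v ∈ T.map Sum.inr ++ A.map Sum.inl := by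
      by_contra h
      exact Finsupp.mem_support_iff.1 hv (listExp_eq_zero h)
    have hAσ : ∀ q ∈ A, q.2 ∈ σ := fun q hq => hσ (by simpa using ⟨q.1, hq⟩)
    rcases List.mem_append.1 hv' with h1 | h1
    · obtain ⟨p, hp, rfl⟩ := List.mem_map.1 h1
      obtain ⟨q, hq, hpq⟩ := hTA p hp
      change p.2 ∈ σ
      rw [hpq]; exact hAσ q hq
    · obtain ⟨p, hp, rfl⟩ := List.mem_map.1 h1
      exact hAσ p hp

end Leading

section Elements
variable {m : ℕ}

theorem listSmaller_cons {A B : List (Fin 3 × Fin m)} {s : Fin 3 × Fin m} (hs : s ∉ A)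
    (h : ∀ p ∈ A, s.1 < p.1 ∨ s.1 = p.1 ∧ s.2 < p.2 → p ∈ B) : ListSmaller (s :: B) A :=
  ⟨s, by simp, fun h => absurd h hs, fun p hp hsp => by simp [h p hp ((idxL_lt_iff _ _).1 hsp)]⟩

theorem minor_apply (i j k : Fin 4) (a b c : Fin m) : minor ![i, j, k] ![a, b, c] =
    ITmatrix m i a * (ITmatrix m j b * ITmatrix m k c - ITmatrix m j c * ITmatrix m k b) -
    ITmatrix m i b * (ITmatrix m j a * ITmatrix m k c - ITmatrix m j c * ITmatrix m k a) +
    ITmatrix m i c * (ITmatrix m j a * ITmatrix m k b - ITmatrix m j b * ITmatrix m k a) := by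
  simp only [minor, Matrix.det_fin_three, Matrix.submatrix_apply, Matrix.cons_val]
  ring

theorem minor_mem_012 {a b c : Fin m} (hab : a ≠ b) (hac : a ≠ c) (hbc : b ≠ c) :
    minor ![0, 1, 2] ![a, b, c] ∈ ITidealOn m Set.univ :=
  minor_mem (injective_vec3 (by decide) (by decide) (by decide)) (injective_vec3 hab hac hbc)

theorem minor_mem_013 {a b c : Fin m} (hab : a ≠ b) (hac : a ≠ c) (hbc : b ≠ c) :
    minor ![0, 1, 3] ![a, b, c] ∈ ITidealOn m Set.univ :=
  minor_mem (injective_vec3 (by decide) (by decide) (by decide)) (injective_vec3 hab hac hbc)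

theorem minor_mem_023 {a b c : Fin m} (hab : a ≠ b) (hac : a ≠ c) (hbc : b ≠ c) :
    minor ![0, 2, 3] ![a, b, c] ∈ ITidealOn m Set.univ :=
  minor_mem (injective_vec3 (by decide) (by decide) (by decide)) (injective_vec3 hab hac hbc)

theorem minor_mem_123 {a b c : Fin m} (hab : a ≠ b) (hac : a ≠ c) (hbc : b ≠ c) :
    minor ![1, 2, 3] ![a, b, c] ∈ ITidealOn m Set.univ :=
  minor_mem (injective_vec3 (by decide) (by decide) (by decide)) (injective_vec3 hab hac hbc)

theorem fiveDivides_three_two_one (hm : 5 ≤ m) {a b c : Fin m} (hab : a < b) (hbc : b < c)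
    {e : (Fin 3 × Fin m) ⊕ (Fin 3 × Fin m) →₀ ℕ} (h3 : e (Sum.inl (2, a)) ≠ 0)
    (h2 : e (Sum.inl (1, b)) ≠ 0) (h1 : e (Sum.inl (0, c)) ≠ 0) : FiveDivides e := by
  have hac := hab.trans hbc
  refine fiveDivides_of_congr hm (minor_mem_012 hab.ne hac.ne hbc.ne)
    (A := [(2, a), (1, b), (0, c)]) (T := []) (by simp) (by simp) (lHomogeneous_minor _ _)
    (c := -1) (by simp) [] (by simp) [[(2, b)], [(2, c)], [(1, c), (2, a)]] ?_ ?_ (by simp)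
    (by simp) (by simp [h1, h2, h3]) (by simp)
  · simp only [List.forall_mem_cons]
    refine ⟨?_, ?_, ?_, by simp⟩ <;> refine listSmaller_cons ?_ ?_ <;> simp <;> order
  · intro S _ ψ hψ
    simp only [lmon, tmon, minor_apply, ITmatrix_zero, ITmatrix_one, ITmatrix_two,
      List.forall_mem_cons, List.map_cons, List.map_nil, List.prod_cons, List.prod_nil, List.sum_nil,
      map_mul, map_sub, map_add, map_neg, mul_one, map_one, map_zero] at hψ ⊢
    grind

theorem fiveDivides_two_one_one (hm : 5 ≤ m) {a b c : Fin m} (hab : a < b) (hbc : b < c)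
    {e : (Fin 3 × Fin m) ⊕ (Fin 3 × Fin m) →₀ ℕ} (h2 : e (Sum.inl (1, a)) ≠ 0)
    (h1 : e (Sum.inl (0, b)) ≠ 0) (h1' : e (Sum.inl (0, c)) ≠ 0)
    (ht : e (Sum.inr (0, b)) ≠ 0) : FiveDivides e := by
  have hac := hab.trans hbc
  refine fiveDivides_of_congr hm (minor_mem_013 hab.ne hac.ne hbc.ne)
    (A := [(1, a), (0, b), (0, c)]) (T := [(0, b)]) (by simp [hbc.ne]) (by simp)
    (lHomogeneous_minor _ _) (c := 1) (by simp) [(-1, [(0, c)])] ?_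
    [[(2, a)], [(2, b)], [(2, c)], [(1, b)], [(1, c)]] ?_ ?_ (by simp)
    (by simp) (by simp [h1, h2, h1']) (by simp [ht])
  · simp only [List.forall_mem_cons]
    refine ⟨⟨listSmaller_cons ?_ ?_, rfl⟩, by simp⟩ <;> simp <;> order
  · simp only [List.forall_mem_cons]
    refine ⟨?_, ?_, ?_, ?_, ?_, by simp⟩ <;> refine listSmaller_cons ?_ ?_ <;> simp <;> order
  · intro S _ ψ hψ
    simp only [lmon, tmon, minor_apply, ITmatrix_zero, ITmatrix_one, ITmatrix_three,
      List.forall_mem_cons, List.map_cons, List.map_nil, List.prod_cons, List.prod_nil, List.sum_cons, List.sum_nil,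
      map_mul, map_sub, map_add, map_neg, mul_one, map_one, map_zero] at hψ ⊢
    grind

theorem fiveDivides_three_one_one (hm : 5 ≤ m) {a b c : Fin m} (hab : a < b) (hbc : b < c)
    {e : (Fin 3 × Fin m) ⊕ (Fin 3 × Fin m) →₀ ℕ} (h3 : e (Sum.inl (2, a)) ≠ 0)
    (h1 : e (Sum.inl (0, b)) ≠ 0) (h1' : e (Sum.inl (0, c)) ≠ 0)
    (ht : e (Sum.inr (0, b)) ≠ 0) : FiveDivides e := by
  have hac := hab.trans hbc
  refine fiveDivides_of_congr hm (minor_mem_023 hab.ne hac.ne hbc.ne)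
    (A := [(2, a), (0, b), (0, c)]) (T := [(0, b)]) (by simp [hbc.ne]) (by simp)
    (lHomogeneous_minor _ _) (c := 1) (by simp) [(-1, [(0, c)])] ?_
    [[(2, b)], [(2, c)], [(1, b), (2, a)], [(1, c), (2, a)]] ?_ ?_ (by simp)
    (by simp) (by simp [h3, h1, h1']) (by simp [ht])
  · simp only [List.forall_mem_cons]
    refine ⟨⟨listSmaller_cons ?_ ?_, rfl⟩, by simp⟩ <;> simp <;> order
  · simp only [List.forall_mem_cons]
    refine ⟨?_, ?_, ?_, ?_, by simp⟩ <;> refine listSmaller_cons ?_ ?_ <;> simp <;> order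
  · intro S _ ψ hψ
    simp only [lmon, tmon, minor_apply, ITmatrix_zero, ITmatrix_two,
      ITmatrix_three, List.forall_mem_cons, List.map_cons, List.map_nil, List.prod_cons,
      List.prod_nil, List.sum_cons, List.sum_nil, map_mul, map_sub, map_add, map_neg, mul_one,
      map_one] at hψ ⊢
    grind

/-- An element of the IT ideal which, modulo `z_d` and `z_e`, equals
`z_c (y_d y_e (t_{2,e} - t_{2,d}) + (t_{1,e} - t_{1,d}) x_d y_e)`. -/
def minorF (c d e : Fin m) : LTRing m :=
  X (Sum.inr (0, e)) * minor ![0, 1, 2] ![c, d, e] - minor ![1, 2, 3] ![c, d, e]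

theorem minorF_mem {c d e : Fin m} (hcd : c < d) (hde : d < e) :
    minorF c d e ∈ ITidealOn m Set.univ :=
  sub_mem (Ideal.mul_mem_left _ _ (minor_mem_012 hcd.ne (hcd.trans hde).ne hde.ne))
    (minor_mem_123 hcd.ne (hcd.trans hde).ne hde.ne)

theorem lHomogeneous_minorF (c d e : Fin m) : LHomogeneous (minorF c d e) 3 :=
  ((lHomogeneous_inr _).mul (lHomogeneous_minor _ _)).sub (lHomogeneous_minor _ _)

theorem fiveDivides_three_one_two (hm : 5 ≤ m) {a b c : Fin m} (hab : a < b) (hbc : b < c)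
    {e : (Fin 3 × Fin m) ⊕ (Fin 3 × Fin m) →₀ ℕ} (h3 : e (Sum.inl (2, a)) ≠ 0)
    (h1 : e (Sum.inl (0, b)) ≠ 0) (h2 : e (Sum.inl (1, c)) ≠ 0)
    (ht : e (Sum.inr (0, b)) ≠ 0) : FiveDivides e := by
  have hac := hab.trans hbc
  refine fiveDivides_of_congr hm (minorF_mem hab hbc)
    (A := [(2, a), (0, b), (1, c)]) (T := [(0, b)]) (by simp) (by simp)
    (lHomogeneous_minorF _ _ _) (c := -1) (by simp) [(1, [(0, c)])] ?_
    [[(2, b)], [(2, c)], [(1, b), (1, c), (2, a)]] ?_ ?_ (by simp)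
    (by simp) (by simp [h3, h1, h2]) (by simp [ht])
  · simp only [List.forall_mem_cons]
    refine ⟨⟨listSmaller_cons ?_ ?_, rfl⟩, by simp⟩ <;> simp <;> order
  · simp only [List.forall_mem_cons]
    refine ⟨?_, ?_, ?_, by simp⟩ <;> refine listSmaller_cons ?_ ?_ <;> simp <;> order
  · intro S _ ψ hψ
    simp only [minorF, lmon, tmon, minor_apply, ITmatrix_zero, ITmatrix_one, ITmatrix_two,
      ITmatrix_three, List.forall_mem_cons, List.map_cons, List.map_nil, List.prod_cons,
      List.prod_nil, List.sum_cons, List.sum_nil, map_mul, map_sub, map_add, map_neg, mul_one,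
      map_one] at hψ ⊢
    grind

theorem fiveDivides_three_two_two_two (hm : 5 ≤ m) {a b c d : Fin m} (hab : a < b) (hbc : b < c)
    (hcd : c < d) {e : (Fin 3 × Fin m) ⊕ (Fin 3 × Fin m) →₀ ℕ} (h3 : e (Sum.inl (2, a)) ≠ 0)
    (hb : e (Sum.inl (1, b)) ≠ 0) (hc : e (Sum.inl (1, c)) ≠ 0) (hd : e (Sum.inl (1, d)) ≠ 0)
    (ht : e (Sum.inr (1, b)) ≠ 0) (ht' : e (Sum.inr (0, c)) ≠ 0) : FiveDivides e := by
  have hac := hab.trans hbc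
  have hbd := hbc.trans hcd
  have hF := fun {c d e : Fin m} (p q r : Fin m) =>
    (((lHomogeneous_inr (0, p)).sub (lHomogeneous_inr (0, q))).mul (lHomogeneous_inl (1, r))).mul
    (lHomogeneous_minorF c d e)
  refine fiveDivides_of_congr hm
    (h := (X (Sum.inr (0, d)) - X (Sum.inr (0, b))) * X (Sum.inl (1, d)) * minorF a b c -
      (X (Sum.inr (0, c)) - X (Sum.inr (0, b))) * X (Sum.inl (1, c)) * minorF a b d)
    (sub_mem (Ideal.mul_mem_left _ _ (minorF_mem hab hbc))
      (Ideal.mul_mem_left _ _ (minorF_mem hab hbd)))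
    (A := [(2, a), (1, b), (1, c), (1, d)]) (T := [(1, b), (0, c)])
    (by simp [hbc.ne, hbd.ne, hcd.ne]) (by simp)
    ((hF _ _ _).sub (hF _ _ _)) (c := 1) (by simp)
    [(-1, [(0, d), (1, b)]), (1, [(1, c), (0, d)]), (-1, [(1, c), (0, b)]), (-1, [(1, d), (0, c)]),
      (1, [(1, d), (0, b)])] ?_
    [[(2, b)], [(2, c)], [(2, d)]] ?_ ?_ (by simp)
    (by simp) (by simp [h3, hb, hc, hd]) (by simp [ht, ht'])
  · simp only [List.forall_mem_cons]
    refine ⟨⟨?_, rfl⟩, ⟨?_, rfl⟩, ⟨?_, rfl⟩, ⟨?_, rfl⟩, ⟨?_, rfl⟩, by simp⟩ <;>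
      refine listSmaller_cons ?_ ?_ <;> simp <;> grind
  · simp only [List.forall_mem_cons]
    refine ⟨?_, ?_, ?_, by simp⟩ <;> refine listSmaller_cons ?_ ?_ <;> simp <;> grind
  · intro S _ ψ hψ
    simp only [minorF, lmon, tmon, minor_apply, ITmatrix_zero, ITmatrix_one, ITmatrix_two,
      ITmatrix_three, List.forall_mem_cons, List.map_cons, List.map_nil, List.prod_cons,
      List.prod_nil, List.sum_cons, List.sum_nil, map_mul, map_sub, map_add, map_neg, mul_one,
      map_one] at hψ ⊢
    grind

theorem fiveDivides_three_one_two_two (hm : 5 ≤ m) {a b c d : Fin m} (hab : a < b) (hbc : b < c)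
    (hcd : c < d) {e : (Fin 3 × Fin m) ⊕ (Fin 3 × Fin m) →₀ ℕ} (h3 : e (Sum.inl (2, a)) ≠ 0)
    (hb : e (Sum.inl (0, b)) ≠ 0) (hc : e (Sum.inl (1, c)) ≠ 0) (hd : e (Sum.inl (1, d)) ≠ 0)
    (ht : e (Sum.inr (0, c)) ≠ 0) : FiveDivides e := by
  have hac := hab.trans hbc
  have hbd := hbc.trans hcd
  have hF := fun {c d e : Fin m} (r : Fin m) =>
    (lHomogeneous_inl (1, r)).mul (lHomogeneous_minorF c d e)
  refine fiveDivides_of_congr hm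
    (h := X (Sum.inl (1, d)) * minorF a b c - X (Sum.inl (1, c)) * minorF a b d)
    (sub_mem (Ideal.mul_mem_left _ _ (minorF_mem hab hbc))
      (Ideal.mul_mem_left _ _ (minorF_mem hab hbd)))
    (A := [(2, a), (0, b), (1, c), (1, d)]) (T := [(0, c)])
    (by simp [hcd.ne]) (by simp)
    ((hF _).sub (hF _)) (c := 1) (by simp)
    [(-1, [(0, d)])] ?_
    [[(2, b)], [(2, c)], [(2, d)], [(1, b), (1, c), (1, d), (2, a)]] ?_ ?_ (by simp)
    (by simp) (by simp [h3, hb, hc, hd]) (by simp [ht])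
  · simp only [List.forall_mem_cons]
    refine ⟨⟨listSmaller_cons ?_ ?_, rfl⟩, by simp⟩ <;> simp <;> grind
  · simp only [List.forall_mem_cons]
    refine ⟨?_, ?_, ?_, ?_, by simp⟩ <;> refine listSmaller_cons ?_ ?_ <;> simp <;> grind
  · intro S _ ψ hψ
    simp only [minorF, lmon, tmon, minor_apply, ITmatrix_zero, ITmatrix_one, ITmatrix_two,
      ITmatrix_three, List.forall_mem_cons, List.map_cons, List.map_nil, List.prod_cons,
      List.prod_nil, List.sum_cons, List.sum_nil, map_mul, map_sub, map_add, map_neg, mul_one,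
      map_one] at hψ ⊢
    grind

theorem fiveDivides_one_one_three_two_two (hm : 5 ≤ m) {a b c d e : Fin m} (hab : a < b)
    (hbc : b ≤ c) (hcd : c < d) (hde : d < e) {k : (Fin 3 × Fin m) ⊕ (Fin 3 × Fin m) →₀ ℕ}
    (ha : k (Sum.inl (0, a)) ≠ 0) (hb : k (Sum.inl (0, b)) ≠ 0) (hc : k (Sum.inl (2, c)) ≠ 0)
    (hd : k (Sum.inl (1, d)) ≠ 0) (he : k (Sum.inl (1, e)) ≠ 0)
    (ht : k (Sum.inr (0, a)) ≠ 0) (ht' : k (Sum.inr (0, d)) ≠ 0) : FiveDivides k := by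
  have hac := hab.trans_le hbc
  have hbd := hbc.trans_lt hcd
  have had := hab.trans hbd
  have hr := fun p : Fin m => lHomogeneous_inr (0, p)
  have hl := fun (i : Fin 3) (p : Fin m) => lHomogeneous_inl (i, p)
  have hM := fun (i : Fin 4) (p : Fin m) => lHomogeneous_ITmatrix i p
  refine fiveDivides_of_congr hm
    (h := X (Sum.inl (2, c)) * X (Sum.inl (1, e)) * (X (Sum.inr (0, e)) - X (Sum.inr (0, d))) *
        minor ![0, 1, 3] ![a, b, d] -
      ((X (Sum.inl (1, a)) * ITmatrix m 3 b - X (Sum.inl (1, b)) * ITmatrix m 3 a) +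
        X (Sum.inr (0, d)) * (X (Sum.inl (0, a)) * X (Sum.inl (1, b)) -
          X (Sum.inl (0, b)) * X (Sum.inl (1, a)))) * minorF c d e)
    (sub_mem (Ideal.mul_mem_left _ _ (minor_mem_013 hab.ne had.ne hbd.ne))
      (Ideal.mul_mem_left _ _ (minorF_mem hcd hde)))
    (A := [(0, a), (0, b), (2, c), (1, d), (1, e)]) (T := [(0, a), (0, d)])
    (by simp [hab.ne, hde.ne]) (by simp [had.ne])
    (((((hl _ _).mul (hl _ _)).mul ((hr _).sub (hr _))).mul (lHomogeneous_minor _ _)).sub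
      (((((hl _ _).mul (hM _ _)).sub ((hl _ _).mul (hM _ _))).add ((hr _).mul
        (((hl _ _).mul (hl _ _)).sub ((hl _ _).mul (hl _ _))) : LHomogeneous _ 2)).mul
        (lHomogeneous_minorF _ _ _)))
    (c := -1) (by simp)
    [(-1, [(0, e), (0, b)]), (1, [(0, e), (0, a)]), (1, [(0, b), (0, d)])] ?_
    [[(2, d)], [(2, e)], [(2, a), (2, c)], [(2, b), (2, c)], [(1, a), (2, c), (1, d), (1, e)],
      [(1, b), (2, c), (1, d), (1, e)]] ?_ ?_ (by simp)
    (by simp) (by simp [ha, hb, hc, hd, he]) (by simp [ht, ht'])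
  · simp only [List.forall_mem_cons]
    refine ⟨⟨?_, rfl⟩, ⟨?_, rfl⟩, ⟨?_, rfl⟩, by simp⟩ <;>
      refine listSmaller_cons ?_ ?_ <;> simp <;> grind
  · simp only [List.forall_mem_cons]
    refine ⟨listSmaller_cons ?_ ?_, listSmaller_cons ?_ ?_, listSmaller_cons ?_ ?_, ?_,
      listSmaller_cons ?_ ?_, listSmaller_cons ?_ ?_, by simp⟩
    case refine_7 =>
      rcases hbc.eq_or_lt with rfl | hbc
      · exact ⟨(2, b), by simp, by simp, by simp [idxL_lt_iff]⟩
      · refine listSmaller_cons ?_ ?_ <;> simp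
        grind
    all_goals simp <;> grind
  · intro S _ ψ hψ
    simp only [minorF, lmon, tmon, minor_apply, ITmatrix_zero, ITmatrix_one, ITmatrix_two,
      ITmatrix_three, List.forall_mem_cons, List.map_cons, List.map_nil, List.prod_cons,
      List.prod_nil, List.sum_cons, List.sum_nil, map_mul, map_sub, map_add, map_neg, mul_one,
      map_one] at hψ ⊢
    grind

end Elements

section Specialization
variable {m : ℕ}

theorem monomial_one_eq_prod {σ : Type*} [Fintype σ] {S : Type*} [CommRing S] [Algebra ℂ S]
    (φ : MvPolynomial σ ℂ →ₐ[ℂ] S) (κ : σ →₀ ℕ) :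
    φ (monomial κ 1) = ∏ v, φ (X v) ^ κ v := by
  rw [monomial_eq, C_1, one_mul, Finsupp.prod_fintype _ _ (by simp), map_prod]
  simp

/-- The IT ideal is homogeneous with respect to the scalings of the individual columns, so a
specialization that kills the minors kills every multihomogeneous component. -/
theorem sum_multidegree_eq_zero {S : Type*} [CommRing S] [Algebra ℂ S]
    (φ : LTRing m →ₐ[ℂ] S) (hφ : ∀ ri ci, φ (minor ri ci) = 0) {f : LTRing m}
    (hf : f ∈ ITidealOn m Set.univ) (d : Fin m → ℕ) :
    ∑ κ ∈ f.support with (∀ j, ∑ i, κ (Sum.inl (i, j)) = d j),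
      coeff κ f • φ (monomial κ 1) = 0 := by
  classical
  set w : (Fin 3 × Fin m) ⊕ (Fin 3 × Fin m) → MvPolynomial (Fin m) S :=
    Sum.elim (fun p => X p.2) (fun _ => 1) with hw
  set Φ : LTRing m →ₐ[ℂ] MvPolynomial (Fin m) S := aeval fun v => C (φ (X v)) * w v with hΦ
  have hΦM : ∀ i j, Φ (ITmatrix m i j) = X j * C (φ (ITmatrix m i j)) := by
    intro i j
    fin_cases i <;>
    simp [ITmatrix_zero, ITmatrix_one, ITmatrix_two, ITmatrix_three, hΦ, hw] <;> ring
  have hker : ∀ f ∈ ITidealOn m Set.univ, Φ f = 0 := by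
    intro f hf
    suffices ITidealOn m Set.univ ≤ RingHom.ker Φ from this hf
    refine Ideal.span_le.2 ?_
    rintro p ⟨ri, ci, -, -, -, rfl⟩
    rw [SetLike.mem_coe, RingHom.mem_ker, AlgHom.map_det]
    have : Φ.mapMatrix ((ITmatrix m).submatrix ri ci) = Matrix.of fun i j =>
        X (ci j) * ((C (σ := Fin m)).mapMatrix (φ.mapMatrix
          ((ITmatrix m).submatrix ri ci))) i j := by
      refine Matrix.ext fun i j => ?_
      simpa using hΦM (ri i) (ci j)
    rw [this, Matrix.det_mul_row, ← RingHom.map_det, ← AlgHom.map_det]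
    have h0 := hφ ri ci
    rw [minor] at h0
    rw [h0, map_zero, mul_zero]
  have hmon : ∀ κ : (Fin 3 × Fin m) ⊕ (Fin 3 × Fin m) →₀ ℕ, Φ (monomial κ 1) =
      monomial (Finsupp.equivFunOnFinite.symm fun j => ∑ i, κ (Sum.inl (i, j)))
        (φ (monomial κ 1)) := by
    intro κ
    have h1 : ∏ v, w v ^ κ v =
        monomial (Finsupp.equivFunOnFinite.symm fun j => ∑ i, κ (Sum.inl (i, j))) 1 := by
      rw [Fintype.prod_sum_type, monomial_eq, C_1, one_mul, Finsupp.prod_fintype _ _ (by simp),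
        Fintype.prod_prod_type_right]
      simp [hw, Finset.prod_pow_eq_pow_sum]
    rw [monomial_one_eq_prod, monomial_one_eq_prod]
    simp only [hΦ, aeval_X, mul_pow, Finset.prod_mul_distrib]
    rw [h1, ← mul_one (∏ v, φ (X v) ^ κ v), ← C_mul_monomial, map_prod]
    simp
  have hsum := hker f hf
  have hfs : Φ f = ∑ κ ∈ f.support, coeff κ f • Φ (monomial κ 1) := by
    conv_lhs => rw [f.as_sum, map_sum]
    refine Finset.sum_congr rfl fun κ _ => ?_
    rw [← map_smul, smul_monomial, smul_eq_mul, mul_one]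
  rw [hfs] at hsum
  have := congrArg (coeff (Finsupp.equivFunOnFinite.symm d)) hsum
  rw [coeff_sum, coeff_zero] at this
  rw [Finset.sum_filter]
  refine Eq.trans ?_ this
  refine Finset.sum_congr rfl fun κ _ => ?_
  rw [hmon, ← algebraMap_smul S (coeff κ f) (monomial _ _), smul_monomial, coeff_monomial,
    algebraMap_smul]
  refine if_congr ?_ rfl rfl
  rw [Equiv.apply_eq_iff_eq, funext_iff]

theorem IsLeadMon.false_of_specialization {W : Type*} {f : LTRing m}
    {b : (Fin 3 × Fin m) ⊕ (Fin 3 × Fin m) →₀ ℕ} (hb : IsLeadMon (prodOrderLT m) f b)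
    (hf : f ∈ ITidealOn m Set.univ) (φ : LTRing m →ₐ[ℂ] Polynomial (MvPolynomial W ℂ))
    (hφ : ∀ ri ci, φ (minor ri ci) = 0) (Θ : Fin 3 × Fin m → ℕ)
    (g : Fin 3 × Fin m → Polynomial (MvPolynomial W ℂ)) (hg : ∀ v, (g v).coeff 0 ≠ 0)
    (hφg : ∀ v, φ (X (Sum.inl v)) = Polynomial.X ^ Θ v * g v)
    (hΘ : ∀ κ : Fin 3 × Fin m →₀ ℕ, (∀ j, ∑ i, κ (i, j) = ∑ i, projL b (i, j)) →
      grevlexL m κ (projL b) → ∑ v, Θ v * projL b v < ∑ v, Θ v * κ v)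
    (μ : W →₀ ℕ) (hμ : coeff μ (∏ v, (φ (X (Sum.inr v))).coeff 0 ^ projT b v) ≠ 0)
    (hμ' : ∀ γ : Fin 3 × Fin m →₀ ℕ, grevlexL m γ (projT b) →
      coeff μ (∏ v, (φ (X (Sum.inr v))).coeff 0 ^ γ v) = 0) : False := by
  classical
  set A := ∑ v, Θ v * projL b v with hA
  set F := f.support.filter fun κ => ∀ j, ∑ i, κ (Sum.inl (i, j)) = ∑ i, projL b (i, j) with hF
  have hsum : ∑ κ ∈ F, coeff κ f • φ (monomial κ 1) = 0 :=
    sum_multidegree_eq_zero φ hφ hf _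
  have hmon : ∀ κ : (Fin 3 × Fin m) ⊕ (Fin 3 × Fin m) →₀ ℕ, φ (monomial κ 1) =
      Polynomial.X ^ (∑ v, Θ v * projL κ v) * ((∏ v, g v ^ projL κ v) *
        ∏ v, φ (X (Sum.inr v)) ^ projT κ v) := by
    intro κ
    rw [monomial_one_eq_prod, Fintype.prod_sum_type, ← mul_assoc]
    congr 1
    simp_rw [hφg, mul_pow, Finset.prod_mul_distrib, ← pow_mul, Finset.prod_pow_eq_pow_sum]
    rfl
  have hbF : b ∈ F := Finset.mem_filter.2 ⟨hb.1, fun j => rfl⟩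
  have hle : ∀ κ ∈ F, A ≤ ∑ v, Θ v * projL κ v ∧
      (projL κ ≠ projL b → A < ∑ v, Θ v * projL κ v) := by
    intro κ hκ
    rw [hF, Finset.mem_filter] at hκ
    by_cases hκb : projL κ = projL b
    · rw [hκb]; exact ⟨le_rfl, fun h => absurd rfl h⟩
    · rcases hb.2 κ hκ.1 (by rintro rfl; exact hκb rfl) with h | h
      · have := hΘ (projL κ) (fun j => by simpa using hκ.2 j) h
        exact ⟨this.le, fun _ => this⟩
      · exact absurd h.1 hκb
  set G0 : MvPolynomial W ℂ := ∏ v, (g v).coeff 0 ^ projL b v with hG0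
  have hG0ne : G0 ≠ 0 := Finset.prod_ne_zero_iff.2 fun v _ => pow_ne_zero _ (hg v)
  set P : (Fin 3 × Fin m →₀ ℕ) → MvPolynomial W ℂ :=
    fun γ => ∏ v, (φ (X (Sum.inr v))).coeff 0 ^ γ v with hP
  have hcoef : ∀ κ ∈ F, (φ (monomial κ 1)).coeff A =
      if projL κ = projL b then G0 * P (projT κ) else 0 := by
    intro κ hκ
    rw [hmon, Polynomial.coeff_X_pow_mul']
    split_ifs with h1 h2 h2
    · rw [h2, Nat.sub_self, Polynomial.mul_coeff_zero, Polynomial.coeff_zero_prod,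
        Polynomial.coeff_zero_prod]
      simp only [hG0, hP, Polynomial.coeff_zero_eq_eval_zero, Polynomial.eval_pow]
    · exact absurd h1 (not_le.2 ((hle κ hκ).2 h2))
    · exact absurd (by rw [h2]) h1
    · rfl
  have h1 := congrArg (fun q : Polynomial (MvPolynomial W ℂ) => q.coeff A) hsum
  simp only [Polynomial.finsetSum_coeff, Polynomial.coeff_smul, Polynomial.coeff_zero] at h1
  rw [Finset.sum_congr rfl fun κ hκ => by rw [hcoef κ hκ]] at h1
  have h2 : G0 * ∑ κ ∈ F, (if projL κ = projL b then coeff κ f • P (projT κ) else 0) = 0 := by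
    refine Eq.trans ?_ h1
    rw [Finset.mul_sum]
    refine Finset.sum_congr rfl fun κ _ => ?_
    split_ifs
    · rw [mul_smul_comm]
    · rw [smul_zero, mul_zero]
  have h3 := congrArg (coeff μ) ((mul_eq_zero.1 h2).resolve_left hG0ne)
  rw [coeff_sum, coeff_zero, Finset.sum_eq_single_of_mem b hbF] at h3
  · rw [if_pos rfl, coeff_smul, smul_eq_mul, mul_eq_zero] at h3
    rcases h3 with h3 | h3
    · exact mem_support_iff.1 hb.1 h3
    · exact hμ h3
  · intro κ hκ hne
    split_ifs with h
    · rcases hb.2 κ (Finset.mem_of_mem_filter κ hκ) hne with h4 | h4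
      · rw [h] at h4
        exact absurd h4 ((grevlexL_isOrderLike m).irrefl _)
      · rw [coeff_smul, hμ' _ h4.2, smul_zero]
    · rw [coeff_zero]

theorem det_eq_zero_of_two_rows {S : Type*} [CommRing S] [IsDomain S]
    {N : Matrix (Fin 4) (Fin m) S} {h p q u w : S} (hh : h ≠ 0)
    (h2 : ∀ j, N 2 j = p * N 0 j + q * N 1 j) (h3 : ∀ j, h * N 3 j = u * N 0 j + w * N 1 j)
    (ri : Fin 3 → Fin 4) (ci : Fin 3 → Fin m) : (N.submatrix ri ci).det = 0 := by
  have key : ∀ i : Fin 4, ∃ a c : S, ∀ j, h * N i j = a * N 0 j + c * N 1 j := by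
    intro i
    fin_cases i
    · exact ⟨h, 0, fun j => by simp⟩
    · exact ⟨0, h, fun j => by simp⟩
    · exact ⟨h * p, h * q, fun j => by
        simp only [Fin.reduceFinMk]; rw [h2]; ring⟩
    · exact ⟨u, w, fun j => h3 j⟩
  choose a c hac using key
  have : h ^ 3 * (N.submatrix ri ci).det = 0 := by
    have : h ^ 3 * (N.submatrix ri ci).det =
        (Matrix.of fun i j => h * N (ri i) (ci j) : Matrix (Fin 3) (Fin 3) S).det := by
      simp only [Matrix.det_fin_three, Matrix.submatrix_apply, Matrix.of_apply]
      ring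
    rw [this]
    simp only [Matrix.det_fin_three, Matrix.of_apply, hac]
    ring
  exact (mul_eq_zero.1 this).resolve_left (pow_ne_zero _ hh)

/-- A family of specializations under which the IT matrix has rank two. -/
def rankTwo {S : Type*} [CommRing S] [Algebra ℂ S] (h D₀ a β γ : S) (T₂ T₃ V : Fin m → S) :
    LTRing m →ₐ[ℂ] S :=
  aeval (Sum.elim
    (fun p => ![h * (T₂ p.2 + β * T₃ p.2) - D₀, h * V p.2,
      β * h * (a * (h * (T₂ p.2 + β * T₃ p.2) - D₀) + V p.2)] p.1)
    (fun p => ![γ - V p.2 - β * h * a * T₃ p.2, T₂ p.2, T₃ p.2] p.1))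

theorem rankTwo_minor {S : Type*} [CommRing S] [IsDomain S] [Algebra ℂ S] {h D₀ a β γ : S}
    {T₂ T₃ V : Fin m → S} (hh : h ≠ 0) (ri : Fin 3 → Fin 4) (ci : Fin 3 → Fin m) :
    rankTwo h D₀ a β γ T₂ T₃ V (minor ri ci) = 0 := by
  rw [minor, AlgHom.map_det]
  refine det_eq_zero_of_two_rows (N := (ITmatrix m).map (rankTwo h D₀ a β γ T₂ T₃ V))
    (p := β * h * a) (q := β) (u := h * γ) (w := D₀) hh ?_ ?_ ri ci
  · intro j
    simp [ITmatrix_zero, ITmatrix_one, ITmatrix_two, rankTwo]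
    ring
  · intro j
    simp [ITmatrix_zero, ITmatrix_one, ITmatrix_three, rankTwo]
    ring

end Specialization

section Weights
variable {m : ℕ}

theorem sum_mul_lt_of_dominant {ι : Type*} [Fintype ι] {Θ α κ : ι → ℕ} {s : ι} {w : ℕ}
    (hs : α s < κ s) (hw : ∀ v, κ v < α v → Θ v ≤ w) (hdom : w * ∑ v, α v < Θ s) :
    ∑ v, Θ v * α v < ∑ v, Θ v * κ v := by
  classical
  have h : ∑ v, (Θ v * α v + if v = s then Θ s else 0) ≤ ∑ v, (Θ v * κ v + w * α v) := by
    refine Finset.sum_le_sum fun v _ => ?_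
    split_ifs with hv
    · subst hv
      nlinarith [Nat.mul_le_mul_left (Θ v) hs]
    · rcases lt_or_ge (κ v) (α v) with h | h
      · nlinarith [Nat.mul_le_mul_right (α v) (hw v h)]
      · nlinarith [Nat.mul_le_mul_left (Θ v) h]
  simp only [Finset.sum_add_distrib, Finset.sum_ite_eq', Finset.mem_univ, if_true,
    ← Finset.mul_sum] at h
  omega

/-- Some column strictly to the left of `j` contains its third line coordinate. -/
def After (α : Fin 3 × Fin m →₀ ℕ) (j : Fin m) : Prop := ∃ a < j, α (2, a) ≠ 0

theorem After.mono {α : Fin 3 × Fin m →₀ ℕ} {j k : Fin m} (h : After α j) (hjk : j ≤ k) :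
    After α k :=
  let ⟨a, ha, h'⟩ := h
  ⟨a, ha.trans_le hjk, h'⟩

/-- The vanishing orders of the line coordinates under the specializations used below. -/
def lineWeight (B η M : ℕ) (E₁ E₂ : Finset (Fin m)) (v : Fin 3 × Fin m) : ℕ :=
  ![0, η + if v.2 ∈ E₁ then B ^ (v.2 + 1 : ℕ) else if v.2 ∈ E₂ then M else 0,
    B ^ (m + 2) + η + if v.2 ∈ E₁ then min M (B ^ (v.2 + 1 : ℕ)) else
      if v.2 ∈ E₂ then B ^ (m + 3 + v.2 : ℕ) else 0] v.1

theorem grevlexL.exists_of_columns_eq {α κ : Fin 3 × Fin m →₀ ℕ}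
    (hcol : ∀ j, ∑ i, κ (i, j) = ∑ i, α (i, j)) (h : grevlexL m κ α) :
    ∃ s, α s < κ s ∧ ∀ t, s.1 < t.1 ∨ s.1 = t.1 ∧ s.2 < t.2 → κ t = α t := by
  have hdeg : monDeg κ = monDeg α := by
    rw [monDeg_eq_sum, monDeg_eq_sum, Fintype.sum_prod_type_right, Fintype.sum_prod_type_right]
    exact Finset.sum_congr rfl fun j _ => hcol j
  rw [grevlexL_iff] at h
  rcases h with h | ⟨-, s, hs, h⟩
  · omega
  · exact ⟨s, hs, fun t ht => h t ((idxL_lt_iff _ _).2 ht)⟩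

theorem sum_lineWeight_lt {α κ : Fin 3 × Fin m →₀ ℕ} {B η M : ℕ} {E₁ E₂ : Finset (Fin m)}
    (hB : B = 3 * ∑ v, α v + 3) (hη : η ≤ 1) (hM : M = 0 ∨ M = B ^ (m + 1))
    (hM' : ∀ j, After α j → α (0, j) ≠ 0 → M = B ^ (m + 1))
    (hE₂ : ∀ j, j ∈ E₂ → After α j)
    (hE₂' : ∀ j, After α j → α (0, j) ≠ 0 ∨ α (1, j) ≠ 0 → j ∈ E₂)
    (hE₁ : ∀ j, j ∈ E₁ → ¬ After α j)
    (hE₁' : ∀ j, ¬ After α j → α (0, j) ≠ 0 → j ∈ E₁ ∨ η = 1 ∧ ∀ k < j, α (1, k) = 0)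
    (h321 : ∀ j k, After α j → α (1, j) ≠ 0 → j < k → α (0, k) = 0)
    (hcol : ∀ j, ∑ i, κ (i, j) = ∑ i, α (i, j)) (hκ : grevlexL m κ α) :
    ∑ v, lineWeight B η M E₁ E₂ v * α v < ∑ v, lineWeight B η M E₁ E₂ v * κ v := by
  obtain ⟨⟨i, j⟩, hs, hright⟩ := grevlexL.exists_of_columns_eq hcol hκ
  set Δ := ∑ v, α v with hΔ
  have hB1 : 1 ≤ B := by omega
  have hpow : ∀ n, 3 * B ^ n * Δ < B ^ (n + 1) := by
    intro n
    have : 1 ≤ B ^ n := Nat.one_le_pow _ _ hB1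
    rw [pow_succ]
    calc 3 * B ^ n * Δ = B ^ n * (3 * Δ) := by ring
      _ < B ^ n * B := Nat.mul_lt_mul_of_pos_left (by omega) this
  have hmono : ∀ {a b : ℕ}, a ≤ b → B ^ a ≤ B ^ b := fun h => Nat.pow_le_pow_right hB1 h
  have hone : ∀ n, 1 ≤ B ^ n := fun n => Nat.one_le_pow _ _ hB1
  have hcol3 : ∀ k, κ (0, k) + κ (1, k) + κ (2, k) = α (0, k) + α (1, k) + α (2, k) := by
    intro k
    simpa [Fin.sum_univ_three] using hcol k
  have hM1 : M ≤ B ^ (m + 1) := by rcases hM with h | h <;> simp [h]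
  have hw0 : ∀ k, lineWeight B η M E₁ E₂ (0, k) = 0 := fun k => rfl
  have hw1 : ∀ k, lineWeight B η M E₁ E₂ (1, k) =
    η + if k ∈ E₁ then B ^ (k + 1 : ℕ) else if k ∈ E₂ then M else 0 := fun k => rfl
  have hw2 : ∀ k, lineWeight B η M E₁ E₂ (2, k) =
    B ^ (m + 2) + η + if k ∈ E₁ then min M (B ^ (k + 1 : ℕ)) else
      if k ∈ E₂ then B ^ (m + 3 + k : ℕ) else 0 := fun k => rfl
  have hw01 : ∀ k, lineWeight B η M E₁ E₂ (1, k) ≤ 3 * B ^ (m + 1) := by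
    intro k
    have h1 : B ^ (k + 1 : ℕ) ≤ B ^ (m + 1) := hmono (by omega)
    have h2 := hone (m + 1)
    rw [hw1]
    split_ifs <;> omega
  fin_cases i
  · -- the rightmost difference cannot be in the first row
    exfalso
    have h1 := hright (1, j) (Or.inl Fin.zero_lt_one)
    have h2 := hright (2, j) (Or.inl (show (0 : Fin 3) < 2 by decide))
    have h3 := hcol3 j
    simp only [Fin.zero_eta] at hs
    omega
  · simp only [Fin.mk_one] at hs hright
    have hx3 : ∀ k, κ (2, k) = α (2, k) := fun k =>
      hright (2, k) (Or.inl (show (1 : Fin 3) < 2 by decide))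
    have hα0 : α (0, j) ≠ 0 := by
      have h1 := hcol3 j
      have h2 := hx3 j
      omega
    have hneg : ∀ v, κ v < α v → v.1 = 0 ∨ v.1 = 1 ∧ v.2 < j := by
      rintro ⟨i, k⟩ hv
      fin_cases i
      · exact Or.inl rfl
      · refine Or.inr ⟨rfl, ?_⟩
        by_contra hk
        rcases (not_lt.1 hk).eq_or_lt with h | h
        · simp only [Fin.mk_one] at h hv
          subst h
          omega
        · exact hv.ne (hright (1, k) (Or.inr ⟨rfl, h⟩))
      · exact absurd (hx3 k) hv.ne
    by_cases hj : After α j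
    · refine sum_mul_lt_of_dominant (s := (1, j)) (w := 3 * B ^ m) hs ?_ ?_
      · rintro ⟨i, k⟩ hv
        rcases hneg _ hv with h | ⟨h, hk⟩ <;> dsimp only at h <;> subst h
        · simp [hw0]
        · have hk' : ¬ After α k := fun h =>
            hα0 (h321 k j h (by omega) hk)
          have h1 : B ^ (k + 1 : ℕ) ≤ B ^ m := hmono (by omega)
          have h2 := hone m
          rw [hw1, if_neg (fun h => hk' (hE₂ k h))]
          split_ifs <;> omega
      · rw [hw1, if_neg (fun h => hE₁ j h hj), if_pos (hE₂' j hj (Or.inl hα0)), hM' j hj hα0]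
        exact (hpow m).trans_le (Nat.le_add_left _ _)
    · have hnA : ∀ k, k < j → ¬ After α k := fun k hk h => hj (h.mono hk.le)
      rcases hE₁' j hj hα0 with h1 | ⟨h1, h1'⟩
      · refine sum_mul_lt_of_dominant (s := (1, j)) (w := 3 * B ^ (j : ℕ)) hs ?_ ?_
        · rintro ⟨i, k⟩ hv
          rcases hneg _ hv with h | ⟨h, hk⟩ <;> dsimp only at h <;> subst h
          · simp [hw0]
          · have h1 : B ^ (k + 1 : ℕ) ≤ B ^ (j : ℕ) := hmono hk
            have h2 := hone j
            rw [hw1, if_neg (fun h => hnA k hk (hE₂ k h))]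
            split_ifs <;> omega
        · rw [hw1, if_pos h1]
          exact (hpow j).trans_le (Nat.le_add_left _ _)
      · refine sum_mul_lt_of_dominant (s := (1, j)) (w := 0) hs ?_ ?_
        · rintro ⟨i, k⟩ hv
          rcases hneg _ hv with h | ⟨h, hk⟩ <;> dsimp only at h <;> subst h
          · simp [hw0]
          · have := h1' k hk
            omega
        · rw [hw1, Nat.zero_mul]
          omega
  · simp only [Fin.reduceFinMk] at hs hright
    have hneg : ∀ k, κ (2, k) < α (2, k) → k < j := by
      intro k hv
      by_contra hk
      rcases (not_lt.1 hk).eq_or_lt with h | h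
      · subst h
        omega
      · exact hv.ne (hright (2, k) (Or.inr ⟨rfl, h⟩))
    by_cases hj : After α j
    · have hα : α (0, j) ≠ 0 ∨ α (1, j) ≠ 0 := by
        have := hcol3 j
        omega
      refine sum_mul_lt_of_dominant (s := (2, j)) (w := 3 * B ^ (m + 2 + j : ℕ)) hs ?_ ?_
      · have hb := hone (m + 2 + j)
        have h1 : B ^ (m + 1) ≤ B ^ (m + 2 + j : ℕ) := hmono (by omega)
        have h2 : B ^ (m + 2) ≤ B ^ (m + 2 + j : ℕ) := hmono (by omega)
        rintro ⟨i, k⟩ hv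
        fin_cases i
        · simp [hw0]
        · exact (hw01 k).trans (by omega)
        · have hk := hneg k hv
          have h3 : B ^ (m + 3 + k : ℕ) ≤ B ^ (m + 2 + j : ℕ) := hmono (by omega)
          have h4 : min M (B ^ (k + 1 : ℕ)) ≤ M := min_le_left _ _
          simp only [Fin.reduceFinMk, hw2]
          split_ifs <;> omega
      · rw [hw2, if_neg (fun h => hE₁ j h hj), if_pos (hE₂' j hj hα)]
        have := hpow (m + 2 + j)
        rw [show m + 2 + (j : ℕ) + 1 = m + 3 + j by ring] at this
        exact this.trans_le (Nat.le_add_left _ _)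
    · refine sum_mul_lt_of_dominant (s := (2, j)) (w := 3 * B ^ (m + 1)) hs ?_ ?_
      · rintro ⟨i, k⟩ hv
        fin_cases i
        · simp [hw0]
        · exact hw01 k
        · exact absurd ⟨k, hneg k hv, by simp only [Fin.reduceFinMk] at hv; omega⟩ hj
      · rw [hw2]
        have := hpow (m + 1)
        exact this.trans_le ((Nat.le_add_right _ _).trans (Nat.le_add_right _ _))

end Weights

section Degeneration
variable {m : ℕ}

/-- The coefficient ring of the one-parameter degenerations: the translations together with three
auxiliary indeterminates. -/
abbrev DegRing (m : ℕ) := MvPolynomial ((Fin 3 × Fin m) ⊕ Fin 3) ℂ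

/-- The image of the first line coordinate of column `j`. -/
def degU (h D₀ : Polynomial (DegRing m)) (B : ℕ) (j : Fin m) : Polynomial (DegRing m) :=
  h * (Polynomial.C (X (Sum.inl (1, j))) +
    Polynomial.X ^ B ^ (m + 2) * Polynomial.C (X (Sum.inl (2, j)))) - D₀

/-- The image of the second line coordinate of column `j`, up to the factor `h`. -/
def degV (h D₀ a : Polynomial (DegRing m)) (B : ℕ) (E₁ E₂ : Finset (Fin m)) (j : Fin m) :
    Polynomial (DegRing m) :=
  if j ∈ E₁ then Polynomial.X ^ B ^ (j + 1 : ℕ)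
  else if j ∈ E₂ then Polynomial.X ^ B ^ (m + 3 + j : ℕ) - a * degU h D₀ B j
  else Polynomial.C (X (Sum.inr 0) - X (Sum.inl (0, j)))

/-- A one-parameter degeneration of the IT matrix within the matrices of rank two. -/
def degeneration (h D₀ a : Polynomial (DegRing m)) (B : ℕ) (E₁ E₂ : Finset (Fin m)) :
    LTRing m →ₐ[ℂ] Polynomial (DegRing m) :=
  rankTwo h D₀ a (Polynomial.X ^ B ^ (m + 2)) (Polynomial.C (X (Sum.inr 0)))
    (fun j => Polynomial.C (X (Sum.inl (1, j)))) (fun j => Polynomial.C (X (Sum.inl (2, j))))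
    (degV h D₀ a B E₁ E₂)

section
variable (h D₀ a : Polynomial (DegRing m)) (B : ℕ) (E₁ E₂ : Finset (Fin m)) (j : Fin m)

theorem degeneration_inl_zero :
    degeneration h D₀ a B E₁ E₂ (X (Sum.inl (0, j))) = degU h D₀ B j := by
  simp [degeneration, rankTwo, degU]

theorem degeneration_inl_one :
    degeneration h D₀ a B E₁ E₂ (X (Sum.inl (1, j))) = h * degV h D₀ a B E₁ E₂ j := by
  simp [degeneration, rankTwo]

theorem degeneration_inl_two :
    degeneration h D₀ a B E₁ E₂ (X (Sum.inl (2, j))) =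
      Polynomial.X ^ B ^ (m + 2) * h * (a * degU h D₀ B j + degV h D₀ a B E₁ E₂ j) := by
  simp [degeneration, rankTwo, degU]

variable {B}

theorem degU_coeff_zero (hB : 1 ≤ B) :
    (degU h D₀ B j).coeff 0 = h.coeff 0 * X (Sum.inl (1, j)) - D₀.coeff 0 := by
  have : B ^ (m + 2) ≠ 0 := pow_ne_zero _ (by omega)
  simp [degU, Polynomial.mul_coeff_zero, Polynomial.coeff_X_pow, this.symm]

theorem degeneration_inr_zero_coeff_zero (hB : 1 ≤ B) :
    (degeneration h D₀ a B E₁ E₂ (X (Sum.inr (0, j)))).coeff 0 =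
      if j ∈ E₁ then X (Sum.inr 0)
      else if j ∈ E₂ then X (Sum.inr 0) + a.coeff 0 *
        (h.coeff 0 * X (Sum.inl (1, j)) - D₀.coeff 0)
      else X (Sum.inl (0, j)) := by
  have h0 : ∀ n, B ^ n ≠ 0 := fun n => pow_ne_zero _ (by omega)
  have : (degeneration h D₀ a B E₁ E₂ (X (Sum.inr (0, j)))).coeff 0 =
      X (Sum.inr 0) - (degV h D₀ a B E₁ E₂ j).coeff 0 := by
    simp [degeneration, rankTwo, Polynomial.mul_coeff_zero, Polynomial.coeff_X_pow,
      (h0 _).symm]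
  rw [this, degV]
  split_ifs
  · simp [Polynomial.coeff_X_pow, (h0 _).symm]
  · simp [Polynomial.mul_coeff_zero, degU_coeff_zero _ _ _ hB, Polynomial.coeff_X_pow,
      (h0 _).symm]
  · rw [Polynomial.coeff_C_zero]
    ring

theorem degeneration_inr_one :
    degeneration h D₀ a B E₁ E₂ (X (Sum.inr (1, j))) = Polynomial.C (X (Sum.inl (1, j))) := by
  simp [degeneration, rankTwo]

theorem degeneration_inr_two :
    degeneration h D₀ a B E₁ E₂ (X (Sum.inr (2, j))) = Polynomial.C (X (Sum.inl (2, j))) := by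
  simp [degeneration, rankTwo]

end

/-- The base of the weights attached to an exponent. -/
def weightBase (b : (Fin 3 × Fin m) ⊕ (Fin 3 × Fin m) →₀ ℕ) : ℕ := 3 * ∑ v, projL b v + 3

/-- The combinatorial hypotheses under which the weights single out the line part of `b`. -/
structure IsAdmissible (α : Fin 3 × Fin m →₀ ℕ) (E₁ E₂ : Finset (Fin m)) : Prop where
  after_of_mem : ∀ j, j ∈ E₂ → After α j
  mem_of_after : ∀ j, After α j → α (0, j) ≠ 0 ∨ α (1, j) ≠ 0 → j ∈ E₂
  not_after_of_mem : ∀ j, j ∈ E₁ → ¬ After α j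
  eq_zero_of_after : ∀ j k, After α j → α (1, j) ≠ 0 → j < k → α (0, k) = 0

/-- The values at the special fibre of the translation coordinates. -/
def tLimit (h D₀ a : Polynomial (DegRing m)) (E₁ E₂ : Finset (Fin m)) (v : Fin 3 × Fin m) :
    DegRing m :=
  if v.1 = 0 then
    if v.2 ∈ E₁ then X (Sum.inr 0)
    else if v.2 ∈ E₂ then X (Sum.inr 0) + a.coeff 0 *
      (h.coeff 0 * X (Sum.inl (1, v.2)) - D₀.coeff 0)
    else X (Sum.inl v)
  else X (Sum.inl v)

theorem degeneration_inr_coeff_zero (h D₀ a : Polynomial (DegRing m)) {B : ℕ} (hB : 1 ≤ B)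
    (E₁ E₂ : Finset (Fin m)) (v : Fin 3 × Fin m) :
    (degeneration h D₀ a B E₁ E₂ (X (Sum.inr v))).coeff 0 = tLimit h D₀ a E₁ E₂ v := by
  obtain ⟨i, j⟩ := v
  fin_cases i
  · exact degeneration_inr_zero_coeff_zero h D₀ a E₁ E₂ j hB
  · refine (congrArg (Polynomial.coeff · 0) (degeneration_inr_one h D₀ a E₁ E₂ j)).trans ?_
    simp [tLimit]
  · refine (congrArg (Polynomial.coeff · 0) (degeneration_inr_two h D₀ a E₁ E₂ j)).trans ?_
    simp [tLimit]

theorem IsLeadMon.false_of_degeneration {f : LTRing m}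
    {b : (Fin 3 × Fin m) ⊕ (Fin 3 × Fin m) →₀ ℕ} (hb : IsLeadMon (prodOrderLT m) f b)
    (hf : f ∈ ITidealOn m Set.univ) {h D₀ a : Polynomial (DegRing m)} (hh : h ≠ 0)
    {E₁ E₂ : Finset (Fin m)} (hE : IsAdmissible (projL b) E₁ E₂) {η M : ℕ} (hη : η ≤ 1)
    (hM : M = 0 ∨ M = weightBase b ^ (m + 1))
    (hM' : ∀ j, After (projL b) j → projL b (0, j) ≠ 0 → M = weightBase b ^ (m + 1))
    (hE₁ : ∀ j, ¬ After (projL b) j → projL b (0, j) ≠ 0 →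
      j ∈ E₁ ∨ η = 1 ∧ ∀ k < j, projL b (1, k) = 0)
    (g₁ g₂ : Fin m → Polynomial (DegRing m))
    (hg₀ : ∀ j, h.coeff 0 * X (Sum.inl (1, j)) - D₀.coeff 0 ≠ 0)
    (hg₁ : ∀ j, (g₁ j).coeff 0 ≠ 0) (hg₂ : ∀ j, (g₂ j).coeff 0 ≠ 0)
    (hV : ∀ j, h * degV h D₀ a (weightBase b) E₁ E₂ j =
      Polynomial.X ^ lineWeight (weightBase b) η M E₁ E₂ (1, j) * g₁ j)
    (hUV : ∀ j, Polynomial.X ^ weightBase b ^ (m + 2) * h * (a * degU h D₀ (weightBase b) j +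
        degV h D₀ a (weightBase b) E₁ E₂ j) =
      Polynomial.X ^ lineWeight (weightBase b) η M E₁ E₂ (2, j) * g₂ j)
    (μ : (Fin 3 × Fin m) ⊕ Fin 3 →₀ ℕ)
    (hμ : coeff μ (∏ v, tLimit h D₀ a E₁ E₂ v ^ projT b v) ≠ 0)
    (hμ' : ∀ γ : Fin 3 × Fin m →₀ ℕ, grevlexL m γ (projT b) →
      coeff μ (∏ v, tLimit h D₀ a E₁ E₂ v ^ γ v) = 0) : False := by
  have hB : 1 ≤ weightBase b := by rw [weightBase]; omega
  refine hb.false_of_specialization hf (degeneration h D₀ a (weightBase b) E₁ E₂)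
    (fun ri ci => rankTwo_minor hh ri ci) (lineWeight (weightBase b) η M E₁ E₂)
    (fun v => ![degU h D₀ (weightBase b) v.2, g₁ v.2, g₂ v.2] v.1) ?_ ?_ ?_ μ ?_ ?_
  · rintro ⟨i, j⟩
    fin_cases i
    · exact (degU_coeff_zero h D₀ j hB).trans_ne (hg₀ j)
    · exact hg₁ j
    · exact hg₂ j
  · rintro ⟨i, j⟩
    fin_cases i
    · refine (degeneration_inl_zero h D₀ a _ E₁ E₂ j).trans ?_
      simp [lineWeight]
    · exact (degeneration_inl_one h D₀ a _ E₁ E₂ j).trans (hV j)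
    · exact (degeneration_inl_two h D₀ a _ E₁ E₂ j).trans (hUV j)
  · exact fun κ hcol hκ => sum_lineWeight_lt rfl hη hM hM' hE.after_of_mem hE.mem_of_after
      hE.not_after_of_mem hE₁ hE.eq_zero_of_after hcol hκ
  · simpa only [degeneration_inr_coeff_zero h D₀ a hB] using hμ
  · simpa only [degeneration_inr_coeff_zero h D₀ a hB] using hμ'

theorem lineWeight_one (B η M : ℕ) (E₁ E₂ : Finset (Fin m)) (j : Fin m) :
    lineWeight B η M E₁ E₂ (1, j) =
      η + if j ∈ E₁ then B ^ (j + 1 : ℕ) else if j ∈ E₂ then M else 0 := rfl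

theorem lineWeight_two (B η M : ℕ) (E₁ E₂ : Finset (Fin m)) (j : Fin m) :
    lineWeight B η M E₁ E₂ (2, j) =
      B ^ (m + 2) + η + if j ∈ E₁ then min M (B ^ (j + 1 : ℕ)) else
        if j ∈ E₂ then B ^ (m + 3 + j : ℕ) else 0 := rfl

theorem X_sub_X_ne_zero {σ : Type*} {i j : σ} (hij : i ≠ j) :
    (X i - X j : MvPolynomial σ ℂ) ≠ 0 :=
  sub_ne_zero.2 fun h => hij (X_injective h)

theorem prod_pow_eq_monomial_mapDomain {σ τ : Type*} [Fintype σ] (π : σ → τ)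
    {t : σ → MvPolynomial τ ℂ} (ht : ∀ v, t v = X (π v)) (γ : σ →₀ ℕ) :
    ∏ v, t v ^ γ v = monomial (γ.mapDomain π) 1 := by
  simp only [ht]
  rw [monomial_eq, C_1, one_mul, Finsupp.prod_mapDomain_index (by simp) (by simp [pow_add]),
    Finsupp.prod_fintype _ _ (by simp)]

theorem IsLeadMon.false_of_degeneration_of_rename {f : LTRing m}
    {b : (Fin 3 × Fin m) ⊕ (Fin 3 × Fin m) →₀ ℕ} (hb : IsLeadMon (prodOrderLT m) f b)
    (hf : f ∈ ITidealOn m Set.univ) {a : Polynomial (DegRing m)}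
    {E₁ E₂ : Finset (Fin m)} (hE : IsAdmissible (projL b) E₁ E₂) {M : ℕ}
    (hM : M = 0 ∨ M = weightBase b ^ (m + 1))
    (hM' : ∀ j, After (projL b) j → projL b (0, j) ≠ 0 → M = weightBase b ^ (m + 1))
    (hE₁ : ∀ j, ¬ After (projL b) j → projL b (0, j) ≠ 0 →
      j ∈ E₁ ∨ ∀ k < j, projL b (1, k) = 0)
    (g₁ g₂ : Fin m → Polynomial (DegRing m))
    (hg₁ : ∀ j, (g₁ j).coeff 0 ≠ 0) (hg₂ : ∀ j, (g₂ j).coeff 0 ≠ 0)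
    (hV : ∀ j, degV Polynomial.X 1 a (weightBase b) E₁ E₂ j =
      Polynomial.X ^ (if j ∈ E₁ then weightBase b ^ (j + 1 : ℕ) else if j ∈ E₂ then M else 0) *
        g₁ j)
    (hUV : ∀ j, a * degU Polynomial.X 1 (weightBase b) j +
        degV Polynomial.X 1 a (weightBase b) E₁ E₂ j =
      Polynomial.X ^ (if j ∈ E₁ then min M (weightBase b ^ (j + 1 : ℕ)) else
        if j ∈ E₂ then weightBase b ^ (m + 3 + j : ℕ) else 0) * g₂ j)
    (π : Fin 3 × Fin m → (Fin 3 × Fin m) ⊕ Fin 3)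
    (hπ : ∀ v, tLimit Polynomial.X 1 a E₁ E₂ v = X (π v))
    (hinj : ∀ γ : Fin 3 × Fin m →₀ ℕ, grevlexL m γ (projT b) →
      γ.mapDomain π ≠ (projT b).mapDomain π) : False := by
  refine hb.false_of_degeneration hf (h := Polynomial.X) (D₀ := 1)
    (a := a) Polynomial.X_ne_zero hE (η := 1) (M := M)
    le_rfl hM hM' (fun j h h' => by simpa using hE₁ j h h')
    g₁ g₂ (by simp) hg₁ hg₂ ?_ ?_ ((projT b).mapDomain π) ?_ ?_
  · intro j
    rw [hV, lineWeight_one, pow_add]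
    ring
  · intro j
    rw [hUV, lineWeight_two, pow_add, pow_add]
    ring
  · rw [prod_pow_eq_monomial_mapDomain π hπ, coeff_monomial, if_pos rfl]
    exact one_ne_zero
  · intro γ hγ
    rw [prod_pow_eq_monomial_mapDomain π hπ, coeff_monomial, if_neg (hinj γ hγ)]

theorem weightBase_pow_ne_zero (b : (Fin 3 × Fin m) ⊕ (Fin 3 × Fin m) →₀ ℕ) (n : ℕ) :
    weightBase b ^ n ≠ 0 :=
  pow_ne_zero _ (by rw [weightBase]; omega)

/-- The degeneration used when no column that has a third line coordinate to its left contains a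
first line coordinate: the first translation coordinates of `E₁` and those of `E₂` are
identified separately. -/
theorem IsLeadMon.false_of_degeneration_separate {f : LTRing m}
    {b : (Fin 3 × Fin m) ⊕ (Fin 3 × Fin m) →₀ ℕ} (hb : IsLeadMon (prodOrderLT m) f b)
    (hf : f ∈ ITidealOn m Set.univ)
    {E₁ E₂ : Finset (Fin m)} (hE : IsAdmissible (projL b) E₁ E₂)
    (hafter : ∀ j, After (projL b) j → projL b (0, j) = 0)
    (hE₁ : ∀ j, ¬ After (projL b) j → projL b (0, j) ≠ 0 →
      j ∈ E₁ ∨ ∀ k < j, projL b (1, k) = 0)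
    (π : Fin 3 × Fin m → (Fin 3 × Fin m) ⊕ Fin 3)
    (hπ : ∀ v, π v = if v.1 = 0 then if v.2 ∈ E₁ then Sum.inr 0 else
      if v.2 ∈ E₂ then Sum.inr 1 else Sum.inl v else Sum.inl v)
    (hinj : ∀ γ : Fin 3 × Fin m →₀ ℕ, grevlexL m γ (projT b) →
      γ.mapDomain π ≠ (projT b).mapDomain π) : False := by
  have hB : 1 ≤ weightBase b := by rw [weightBase]; omega
  have h0 := weightBase_pow_ne_zero b
  set a : Polynomial (DegRing m) := Polynomial.C (X (Sum.inr 0) - X (Sum.inr 1)) with ha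
  refine hb.false_of_degeneration_of_rename hf (a := a) hE (M := 0)
    (Or.inl rfl) (fun j h h' => absurd (hafter j h) h') hE₁
    (fun j => if j ∈ E₁ then 1 else degV Polynomial.X 1 a (weightBase b) E₁ E₂ j)
    (fun j => if j ∈ E₁ then a * degU Polynomial.X 1 (weightBase b) j +
      Polynomial.X ^ weightBase b ^ (j + 1 : ℕ) else if j ∈ E₂ then 1 else
      a * degU Polynomial.X 1 (weightBase b) j +
      Polynomial.C (X (Sum.inr 0) - X (Sum.inl (0, j)))) ?_ ?_ ?_ ?_ π ?_ hinj
  · intro j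
    simp only [degV]
    split_ifs with h1 h2
    · simp
    · simp [Polynomial.mul_coeff_zero, degU_coeff_zero _ _ _ hB, Polynomial.coeff_X_pow, ha,
        (h0 _).symm, sub_eq_zero]
    · rw [Polynomial.coeff_C_zero]
      exact X_sub_X_ne_zero (by simp)
  · intro j
    split_ifs with h1 h2
    · simp [Polynomial.mul_coeff_zero, degU_coeff_zero _ _ _ hB, Polynomial.coeff_X_pow, ha,
        (h0 _).symm, sub_eq_zero]
    · simp
    · simp [Polynomial.mul_coeff_zero, degU_coeff_zero _ _ _ hB, ha, sub_eq_zero]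
  · intro j
    simp only [degV]
    split_ifs <;> simp
  · intro j
    simp only [degV, Nat.zero_min]
    split_ifs <;> simp
  · rintro ⟨i, j⟩
    simp only [tLimit, hπ]
    split_ifs <;> simp [ha]

/-- The degeneration used when some column that has a third line coordinate to its left contains a
first line coordinate: the first translation coordinates of `E₁` and `E₂` are all identified. -/
theorem IsLeadMon.false_of_degeneration_joint {f : LTRing m}
    {b : (Fin 3 × Fin m) ⊕ (Fin 3 × Fin m) →₀ ℕ} (hb : IsLeadMon (prodOrderLT m) f b)
    (hf : f ∈ ITidealOn m Set.univ)
    {E₁ E₂ : Finset (Fin m)} (hE : IsAdmissible (projL b) E₁ E₂)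
    (hE₁ : ∀ j, ¬ After (projL b) j → projL b (0, j) ≠ 0 →
      j ∈ E₁ ∨ ∀ k < j, projL b (1, k) = 0)
    (π : Fin 3 × Fin m → (Fin 3 × Fin m) ⊕ Fin 3)
    (hπ : ∀ v, π v = if v.1 = 0 then if v.2 ∈ E₁ then Sum.inr 0 else
      if v.2 ∈ E₂ then Sum.inr 0 else Sum.inl v else Sum.inl v)
    (hinj : ∀ γ : Fin 3 × Fin m →₀ ℕ, grevlexL m γ (projT b) →
      γ.mapDomain π ≠ (projT b).mapDomain π) : False := by
  have hB : 1 ≤ weightBase b := by rw [weightBase]; omega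
  have hB2 : 2 ≤ weightBase b := by rw [weightBase]; omega
  have h0 := weightBase_pow_ne_zero b
  set M := weightBase b ^ (m + 1) with hM
  have hMN : ∀ j : Fin m, weightBase b ^ (j + 1 : ℕ) < M := fun j =>
    Nat.pow_lt_pow_right hB2 (by omega)
  have hHM : ∀ j : Fin m, M < weightBase b ^ (m + 3 + j : ℕ) := fun j =>
    Nat.pow_lt_pow_right hB2 (by omega)
  set a : Polynomial (DegRing m) := Polynomial.X ^ M with ha
  have ha0 : a.coeff 0 = 0 := by simp [ha, Polynomial.coeff_X_pow, hM, (h0 _).symm]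
  set U := degU (m := m) Polynomial.X 1 (weightBase b) with hU
  have hU0 : ∀ j, (U j).coeff 0 = -1 := fun j => by
    simp [hU, degU_coeff_zero _ _ _ hB]
  refine hb.false_of_degeneration_of_rename hf (a := a) hE (M := M)
    (Or.inr rfl) (fun _ _ _ => rfl) hE₁
    (fun j => if j ∈ E₁ then 1 else if j ∈ E₂ then
      Polynomial.X ^ (weightBase b ^ (m + 3 + j : ℕ) - M) - U j else
        Polynomial.C (X (Sum.inr 0) - X (Sum.inl (0, j))))
    (fun j => if j ∈ E₁ then Polynomial.X ^ (M - weightBase b ^ (j + 1 : ℕ)) * U j + 1 else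
      if j ∈ E₂ then 1 else
      a * U j + Polynomial.C (X (Sum.inr 0) - X (Sum.inl (0, j)))) ?_ ?_ ?_ ?_ π ?_ hinj
  · intro j
    split_ifs with h1 h2
    · simp
    · have := hHM j
      rw [Polynomial.coeff_sub, hU0, Polynomial.coeff_X_pow, if_neg (by omega)]
      simp
    · rw [Polynomial.coeff_C_zero]
      exact X_sub_X_ne_zero (by simp)
  · intro j
    split_ifs with h1 h2
    · have := hMN j
      rw [Polynomial.coeff_add, Polynomial.mul_coeff_zero, Polynomial.coeff_X_pow,
        if_neg (by omega)]
      simp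
    · simp
    · rw [Polynomial.coeff_add, Polynomial.mul_coeff_zero, ha0, zero_mul, zero_add,
        Polynomial.coeff_C_zero]
      exact X_sub_X_ne_zero (by simp)
  · intro j
    simp only [degV]
    split_ifs with h1 h2
    · simp
    · rw [mul_sub, ← pow_add, Nat.add_sub_cancel' (hHM j).le]
    · simp
  · intro j
    simp only [degV]
    split_ifs with h1 h2
    · rw [min_eq_right (hMN j).le, mul_add, ← mul_assoc, ← pow_add,
        Nat.add_sub_cancel' (hMN j).le, mul_one]
    · ring
    · simp [hU]
  · rintro ⟨i, j⟩
    simp only [tLimit, hπ, ha0]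
    split_ifs <;> simp

/-- The degeneration used when the second line and first translation coordinates of the columns
in `E₂` interact. -/
theorem IsLeadMon.false_of_degeneration_mixed {f : LTRing m}
    {b : (Fin 3 × Fin m) ⊕ (Fin 3 × Fin m) →₀ ℕ} (hb : IsLeadMon (prodOrderLT m) f b)
    (hf : f ∈ ITidealOn m Set.univ)
    {E₁ E₂ : Finset (Fin m)} (hE : IsAdmissible (projL b) E₁ E₂)
    (hafter : ∀ j, After (projL b) j → projL b (0, j) = 0)
    (hE₁ : ∀ j, ¬ After (projL b) j → projL b (0, j) ≠ 0 → j ∈ E₁)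
    (t : Fin 3 × Fin m → DegRing m)
    (ht : ∀ v, t v = if v.1 = 0 then if v.2 ∈ E₁ then X (Sum.inr 0) else
      if v.2 ∈ E₂ then X (Sum.inr 1) + X (Sum.inr 2) * X (Sum.inl (1, v.2))
        else X (Sum.inl v) else X (Sum.inl v))
    (μ : (Fin 3 × Fin m) ⊕ Fin 3 →₀ ℕ) (hμ : coeff μ (∏ v, t v ^ projT b v) ≠ 0)
    (hμ' : ∀ γ : Fin 3 × Fin m →₀ ℕ, grevlexL m γ (projT b) →
      coeff μ (∏ v, t v ^ γ v) = 0) : False := by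
  classical
  have hB : 1 ≤ weightBase b := by rw [weightBase]; omega
  have h0 := weightBase_pow_ne_zero b
  set q : DegRing m := X (Sum.inr 2) with hq
  have hq0 : q ≠ 0 := X_ne_zero _
  set D : DegRing m := X (Sum.inr 0) - X (Sum.inr 1) with hD
  have hU0 : ∀ j, (degU (Polynomial.C q) (Polynomial.C D) (weightBase b) j).coeff 0 =
      q * X (Sum.inl (1, j)) - D := fun j => by
    simp [degU_coeff_zero _ _ _ hB]
  have hUne : ∀ j : Fin m, q * X (Sum.inl (1, j)) - D ≠ 0 := fun j h => by
    simpa [hq, hD] using congrArg (eval (Pi.single (Sum.inr 0) (1 : ℂ))) h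
  have htl : tLimit (Polynomial.C q) (Polynomial.C D) 1 E₁ E₂ = t := by
    funext v
    simp only [tLimit, ht, Polynomial.coeff_C_zero, Polynomial.coeff_one_zero]
    split_ifs <;> first | rfl | (rw [hq, hD]; ring)
  refine hb.false_of_degeneration hf (h := Polynomial.C q) (D₀ := Polynomial.C D) (a := 1)
    (by simpa using hq0) hE (η := 0) (M := 0) zero_le_one (Or.inl rfl)
    (fun j h h' => absurd (hafter j h) h') (fun j h h' => Or.inl (hE₁ j h h'))
    (fun j => Polynomial.C q * if j ∈ E₁ then 1 else
      degV (Polynomial.C q) (Polynomial.C D) 1 (weightBase b) E₁ E₂ j)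
    (fun j => Polynomial.C q * if j ∈ E₁ then
      degU (Polynomial.C q) (Polynomial.C D) (weightBase b) j +
        Polynomial.X ^ weightBase b ^ (j + 1 : ℕ) else if j ∈ E₂ then 1 else
      degU (Polynomial.C q) (Polynomial.C D) (weightBase b) j +
        Polynomial.C (X (Sum.inr 0) - X (Sum.inl (0, j))))
    (fun j => by simpa using hUne j) ?_ ?_ ?_ ?_ μ (by rwa [htl]) (by rwa [htl])
  · intro j
    rw [Polynomial.mul_coeff_zero, Polynomial.coeff_C_zero]
    refine mul_ne_zero hq0 ?_
    simp only [degV]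
    split_ifs with h1 h2
    · simp
    · rw [one_mul, Polynomial.coeff_sub, hU0, Polynomial.coeff_X_pow, if_neg (h0 _).symm, zero_sub]
      exact neg_ne_zero.2 (hUne j)
    · rw [Polynomial.coeff_C_zero]
      exact X_sub_X_ne_zero (by simp)
  · intro j
    rw [Polynomial.mul_coeff_zero, Polynomial.coeff_C_zero]
    refine mul_ne_zero hq0 ?_
    split_ifs with h1 h2
    · rw [Polynomial.coeff_add, hU0, Polynomial.coeff_X_pow, if_neg (h0 _).symm, add_zero]
      exact hUne j
    · simp
    · rw [Polynomial.coeff_add, hU0, Polynomial.coeff_C_zero]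
      intro h
      simpa [hq, hD] using congrArg (eval (Pi.single (Sum.inl (0, j)) (1 : ℂ))) h
  · intro j
    rw [lineWeight_one]
    simp only [degV]
    split_ifs <;> ring
  · intro j
    rw [lineWeight_two, pow_add, pow_add, Nat.zero_min]
    simp only [degV]
    split_ifs <;> ring

end Degeneration

section TranslationPart
variable {m : ℕ}

theorem grevlexL.exists_of_monDeg_eq {β γ : Fin 3 × Fin m →₀ ℕ} (h : grevlexL m γ β)
    (hdeg : monDeg γ = monDeg β) :
    ∃ s, β s < γ s ∧ ∀ t, s.1 < t.1 ∨ s.1 = t.1 ∧ s.2 < t.2 → γ t = β t := by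
  rw [grevlexL_iff] at h
  rcases h with h | ⟨-, s, hs, h⟩
  · omega
  · exact ⟨s, hs, fun t ht => h t ((idxL_lt_iff _ _).2 ht)⟩

theorem monDeg_mapDomain {σ τ : Type*} (π : σ → τ) (γ : σ →₀ ℕ) :
    monDeg (γ.mapDomain π) = monDeg γ :=
  Finsupp.sum_mapDomain_index (by simp) (by simp)

theorem mapDomain_ne_of_grevlexL {τ : Type*} {π : Fin 3 × Fin m → τ} {β γ : Fin 3 × Fin m →₀ ℕ}
    (h : grevlexL m γ β)
    (hβ : ∀ v w, π v = π w → (v.1 < w.1 ∨ v.1 = w.1 ∧ v.2 < w.2) → β v = 0) :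
    γ.mapDomain π ≠ β.mapDomain π := by
  classical
  intro heq
  have hdeg : monDeg γ = monDeg β := by rw [← monDeg_mapDomain π, heq, monDeg_mapDomain]
  obtain ⟨s, hs, hright⟩ := h.exists_of_monDeg_eq hdeg
  have hval : ∀ δ : Fin 3 × Fin m →₀ ℕ, δ.mapDomain π (π s) = ∑ v with π v = π s, δ v := by
    intro δ
    rw [Finsupp.mapDomain, Finsupp.sum_apply, Finsupp.sum_fintype _ _ (by simp),
      Finset.sum_filter]
    simp [Finsupp.single_apply]
  have hsum := DFunLike.congr_fun heq (π s)
  rw [hval, hval] at hsum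
  refine (Finset.sum_lt_sum (fun v hv => ?_) ⟨s, by simp, hs⟩).ne' hsum
  rw [Finset.mem_filter] at hv
  rcases lt_trichotomy v.1 s.1 with h1 | h1 | h1
  · simp [hβ v s hv.2 (Or.inl h1)]
  · rcases lt_trichotomy v.2 s.2 with h2 | h2 | h2
    · simp [hβ v s hv.2 (Or.inr ⟨h1, h2⟩)]
    · rw [Prod.ext h1 h2]
      exact hs.le
    · exact (hright v (Or.inr ⟨h1.symm, h2⟩)).ge
  · exact (hright v (Or.inl h1)).ge

theorem support_prod_pow_induction {σ τ R : Type*} [Fintype σ] [CommSemiring R]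
    (t : σ → MvPolynomial τ R) (C : (σ →₀ ℕ) → (τ →₀ ℕ) → Prop) (h0 : C 0 0)
    (hadd : ∀ γ γ' μ μ', C γ μ → C γ' μ' → C (γ + γ') (μ + μ'))
    (hsingle : ∀ v, ∀ μ ∈ (t v).support, C (Finsupp.single v 1) μ) (γ : σ →₀ ℕ) :
    ∀ μ ∈ (∏ v, t v ^ γ v).support, C γ μ := by
  classical
  have hone : ∀ μ ∈ (1 : MvPolynomial τ R).support, μ = 0 := by
    intro μ hμ
    by_contra h
    exact mem_support_iff.1 hμ (by rw [coeff_one, if_neg (Ne.symm h)])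
  induction γ using Finsupp.induction_linear with
  | zero =>
    intro μ hμ
    simp only [Finsupp.coe_zero, Pi.zero_apply, pow_zero, Finset.prod_const_one] at hμ
    rw [hone μ hμ]
    exact h0
  | add γ γ' hγ hγ' =>
    intro μ hμ
    simp only [Finsupp.add_apply, pow_add, Finset.prod_mul_distrib] at hμ
    obtain ⟨a, ha, b, hb, rfl⟩ := Finset.mem_add.1 (support_mul _ _ hμ)
    exact hadd _ _ _ _ (hγ a ha) (hγ' b hb)
  | single v n =>
    have hprod : ∏ w, t w ^ (Finsupp.single v n : σ →₀ ℕ) w = t v ^ n := by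
      rw [Finset.prod_eq_single v (fun w _ hw => by simp [hw.symm]) (by simp)]
      simp
    rw [hprod]
    induction n with
    | zero =>
      intro μ hμ
      rw [pow_zero] at hμ
      rw [hone μ hμ, Finsupp.single_zero]
      exact h0
    | succ n ih =>
      intro μ hμ
      rw [pow_succ] at hμ
      obtain ⟨a, ha, b, hb, rfl⟩ := Finset.mem_add.1 (support_mul _ _ hμ)
      rw [Finsupp.single_add]
      refine hadd _ _ _ _ (ih ?_ a ha) (hsingle v b hb)
      rw [Finset.prod_eq_single v (fun w _ hw => by simp [hw.symm]) (by simp)]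
      simp

theorem mem_support_mul_of_nat {τ : Type*} {p q : MvPolynomial τ ℕ} {a b : τ →₀ ℕ}
    (ha : a ∈ p.support) (hb : b ∈ q.support) : a + b ∈ (p * q).support := by
  classical
  rw [mem_support_iff] at ha hb ⊢
  rw [coeff_mul]
  intro h
  have := Finset.sum_eq_zero_iff.1 h (a, b) (Finset.HasAntidiagonal.mem_antidiagonal.2 rfl)
  simp_all

theorem mem_support_prod_pow_of_nat {σ τ : Type*} (s : Finset σ) (t : σ → MvPolynomial τ ℕ)
    (e : σ → τ →₀ ℕ) (he : ∀ v, e v ∈ (t v).support) (γ : σ → ℕ) :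
    ∑ v ∈ s, γ v • e v ∈ (∏ v ∈ s, t v ^ γ v).support := by
  classical
  have hpow : ∀ v n, n • e v ∈ (t v ^ n).support := by
    intro v n
    induction n with
    | zero => simp
    | succ n ih =>
      rw [succ_nsmul, pow_succ]
      exact mem_support_mul_of_nat ih (he v)
  induction s using Finset.induction_on with
  | empty => simp
  | insert a s ha ih =>
    rw [Finset.sum_insert ha, Finset.prod_insert ha]
    exact mem_support_mul_of_nat (hpow a _) ih

/-- The special fibre of the first translation coordinates in the mixed degeneration. -/
def mixedT (R : Type*) [CommSemiring R] (E₁ E₂ : Finset (Fin m)) (v : Fin 3 × Fin m) :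
    MvPolynomial ((Fin 3 × Fin m) ⊕ Fin 3) R :=
  if v.1 = 0 then if v.2 ∈ E₁ then X (Sum.inr 0) else
    if v.2 ∈ E₂ then X (Sum.inr 1) + X (Sum.inr 2) * X (Sum.inl (1, v.2))
      else X (Sum.inl v) else X (Sum.inl v)

/-- The linear constraints satisfied by the exponents of a product of powers of `mixedT`. -/
structure MixedRel (E₁ E₂ : Finset (Fin m)) (γ : Fin 3 × Fin m →₀ ℕ)
    (μ : (Fin 3 × Fin m) ⊕ Fin 3 →₀ ℕ) : Prop where
  free₀ : ∀ j, j ∉ E₁ → j ∉ E₂ → μ (Sum.inl (0, j)) = γ (0, j)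
  free₁ : ∀ j, j ∉ E₂ → μ (Sum.inl (1, j)) = γ (1, j)
  free₂ : ∀ j, μ (Sum.inl (2, j)) = γ (2, j)
  le : ∀ j ∈ E₂, γ (1, j) ≤ μ (Sum.inl (1, j))
  le_add : ∀ j ∈ E₂, μ (Sum.inl (1, j)) ≤ γ (1, j) + γ (0, j)
  sum_one : ∑ j ∈ E₂, μ (Sum.inl (1, j)) = ∑ j ∈ E₂, γ (1, j) + μ (Sum.inr 2)
  sum_zero : ∑ j ∈ E₂, γ (0, j) = μ (Sum.inr 2) + μ (Sum.inr 1)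
  sum_left : ∑ j ∈ E₁, γ (0, j) = μ (Sum.inr 0)
  deg : monDeg γ + μ (Sum.inr 2) = monDeg μ

theorem MixedRel.add {E₁ E₂ : Finset (Fin m)} {γ γ' : Fin 3 × Fin m →₀ ℕ}
    {μ μ' : (Fin 3 × Fin m) ⊕ Fin 3 →₀ ℕ} (h : MixedRel E₁ E₂ γ μ) (h' : MixedRel E₁ E₂ γ' μ') :
    MixedRel E₁ E₂ (γ + γ') (μ + μ') where
  free₀ j h1 h2 := by simp [h.free₀ j h1 h2, h'.free₀ j h1 h2]
  free₁ j h1 := by simp [h.free₁ j h1, h'.free₁ j h1]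
  free₂ j := by simp [h.free₂ j, h'.free₂ j]
  le j hj := by simpa using add_le_add (h.le j hj) (h'.le j hj)
  le_add j hj := by
    have h1 := h.le_add j hj
    have h2 := h'.le_add j hj
    simp only [Finsupp.add_apply]
    omega
  sum_one := by
    have h1 := h.sum_one
    have h2 := h'.sum_one
    simp only [Finsupp.add_apply, Finset.sum_add_distrib]
    omega
  sum_zero := by
    have h1 := h.sum_zero
    have h2 := h'.sum_zero
    simp only [Finsupp.add_apply, Finset.sum_add_distrib]
    omega
  sum_left := by
    have h1 := h.sum_left
    have h2 := h'.sum_left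
    simp only [Finsupp.add_apply, Finset.sum_add_distrib]
    omega
  deg := by
    have h1 := h.deg
    have h2 := h'.deg
    simp only [monDeg_add, Finsupp.add_apply]
    omega

theorem MixedRel.single {E₁ E₂ : Finset (Fin m)} (hE : Disjoint E₁ E₂) (v : Fin 3 × Fin m)
    {μ : (Fin 3 × Fin m) ⊕ Fin 3 →₀ ℕ}
    (hμ : (v.1 = 0 ∧ v.2 ∈ E₁ ∧ μ = Finsupp.single (Sum.inr 0) 1) ∨
      (v.1 = 0 ∧ v.2 ∈ E₂ ∧ μ = Finsupp.single (Sum.inr 1) 1) ∨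
      (v.1 = 0 ∧ v.2 ∈ E₂ ∧ μ = Finsupp.single (Sum.inr 2) 1 +
        Finsupp.single (Sum.inl (1, v.2)) 1) ∨
      ((v.1 = 0 → v.2 ∉ E₁ ∧ v.2 ∉ E₂) ∧ μ = Finsupp.single (Sum.inl v) 1)) :
    MixedRel E₁ E₂ (Finsupp.single v 1) μ := by
  classical
  obtain ⟨i, k⟩ := v
  dsimp only at hμ
  rcases hμ with ⟨rfl, hk, rfl⟩ | ⟨rfl, hk, rfl⟩ | ⟨rfl, hk, rfl⟩ | ⟨hk, rfl⟩
  · have hk' := Finset.disjoint_left.1 hE hk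
    constructor <;> intros <;> simp_all [monDeg_single, Finsupp.single_apply, Prod.ext_iff]
    rintro rfl; contradiction
  · have hk' := Finset.disjoint_right.1 hE hk
    constructor <;> intros <;> simp_all [monDeg_single, Finsupp.single_apply, Prod.ext_iff]
    rintro rfl; contradiction
  · have hk' := Finset.disjoint_right.1 hE hk
    constructor <;> intros <;>
      simp_all [monDeg_single, monDeg_add, Finsupp.single_apply, Prod.ext_iff]
    all_goals rintro rfl; contradiction
  · constructor <;> intros <;> simp_all [monDeg_single, Finsupp.single_apply, Prod.ext_iff]
    all_goals
      rintro x hx rfl rfl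
      exact absurd hx (by simp_all)

theorem MixedRel.of_mem_support {R : Type*} [CommSemiring R] {E₁ E₂ : Finset (Fin m)}
    (hE : Disjoint E₁ E₂) (γ : Fin 3 × Fin m →₀ ℕ) {μ : (Fin 3 × Fin m) ⊕ Fin 3 →₀ ℕ}
    (hμ : μ ∈ (∏ v, mixedT R E₁ E₂ v ^ γ v).support) : MixedRel E₁ E₂ γ μ := by
  classical
  refine support_prod_pow_induction (mixedT R E₁ E₂) (MixedRel E₁ E₂) ?_
    (fun _ _ _ _ => MixedRel.add) (fun v μ hμ => MixedRel.single hE v ?_) γ μ hμ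
  · constructor <;> simp [monDeg]
  · have hX : ∀ (s : (Fin 3 × Fin m) ⊕ Fin 3) (μ : (Fin 3 × Fin m) ⊕ Fin 3 →₀ ℕ),
        μ ∈ (X s : MvPolynomial _ R).support → μ = Finsupp.single s 1 := fun s μ h =>
      Finset.mem_singleton.1 (support_monomial_subset h)
    rw [mixedT] at hμ
    split_ifs at hμ with h0 h1 h2
    · exact Or.inl ⟨h0, h1, hX _ _ hμ⟩
    · rcases Finset.mem_union.1 (support_add hμ) with h | h
      · exact Or.inr (Or.inl ⟨h0, h2, hX _ _ h⟩)
      · obtain ⟨a, ha, b, hb, rfl⟩ := Finset.mem_add.1 (support_mul _ _ h)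
        exact Or.inr (Or.inr (Or.inl ⟨h0, h2, by rw [hX _ _ ha, hX _ _ hb]⟩))
    · exact Or.inr (Or.inr (Or.inr ⟨fun _ => ⟨h1, h2⟩, hX _ _ hμ⟩))
    · exact Or.inr (Or.inr (Or.inr ⟨fun h => absurd h h0, hX _ _ hμ⟩))

theorem exists_mem_support_mixedT (E₁ E₂ : Finset (Fin m)) (hE : Disjoint E₁ E₂)
    (f : Fin m) (β : Fin 3 × Fin m →₀ ℕ) :
    ∃ μ ∈ (∏ v, mixedT ℂ E₁ E₂ v ^ β v).support,
      (∀ e ∈ E₂, e ≠ f → μ (Sum.inl (1, e)) = β (1, e) + β (0, e)) ∧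
      μ (Sum.inl (1, f)) = β (1, f) := by
  classical
  set e : Fin 3 × Fin m → (Fin 3 × Fin m) ⊕ Fin 3 →₀ ℕ := fun v =>
    if v.1 = 0 then if v.2 ∈ E₁ then Finsupp.single (Sum.inr 0) 1 else
      if v.2 ∈ E₂ then if v.2 = f then Finsupp.single (Sum.inr 1) 1 else
        Finsupp.single (Sum.inr 2) 1 + Finsupp.single (Sum.inl (1, v.2)) 1
      else Finsupp.single (Sum.inl v) 1 else Finsupp.single (Sum.inl v) 1 with he
  have hsupp : ∀ v, e v ∈ (mixedT ℕ E₁ E₂ v).support := by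
    intro v
    rw [mem_support_iff]
    simp only [he, mixedT]
    split_ifs <;> simp [X, monomial_mul, coeff_monomial]
  have hmap : ∀ v, mixedT ℂ E₁ E₂ v = map (Nat.castRingHom ℂ) (mixedT ℕ E₁ E₂ v) := by
    intro v
    simp only [mixedT]
    split_ifs <;> simp
  refine ⟨∑ v, β v • e v, ?_, ?_, ?_⟩
  · have := mem_support_prod_pow_of_nat Finset.univ (mixedT ℕ E₁ E₂) e hsupp β
    simp only [hmap, ← map_pow, ← map_prod]
    rw [mem_support_iff, coeff_map] at *
    simpa using this
  · intro k hk hkf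
    have h0 : ∀ j, e (0, j) (Sum.inl (1, k)) = if j = k then 1 else 0 := by
      intro j
      have hk1 := Finset.disjoint_right.1 hE hk
      by_cases hjk : j = k
      · subst hjk
        simp [he, hk1, hk, hkf]
      · simp only [he]
        split_ifs <;> simp [hjk]
    have h1 : ∀ j, e (1, j) (Sum.inl (1, k)) = if j = k then 1 else 0 := by
      intro j
      simp [he, Finsupp.single_apply]
    have h2 : ∀ j, e (2, j) (Sum.inl (1, k)) = 0 := by
      intro j
      simp [he]
    simp [Fintype.sum_prod_type, Fin.sum_univ_three, h0, h1, h2,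
      add_comm]
  · have h0 : ∀ j, e (0, j) (Sum.inl (1, f)) = 0 := by
      intro j
      simp only [he]
      split_ifs <;> simp_all
    have h1 : ∀ j, e (1, j) (Sum.inl (1, f)) = if j = f then 1 else 0 := by
      intro j
      simp [he, Finsupp.single_apply]
    have h2 : ∀ j, e (2, j) (Sum.inl (1, f)) = 0 := by
      intro j
      simp [he]
    simp [Fintype.sum_prod_type, Fin.sum_univ_three, h0, h1, h2]

theorem exists_coeff_prod_mixedT_ne_zero {E₁ E₂ : Finset (Fin m)} (hE : Disjoint E₁ E₂)
    (hne : E₂.Nonempty) {β : Fin 3 × Fin m →₀ ℕ}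
    (hβ₁ : ∀ a ∈ E₁, ∀ c ∈ E₁, a < c → β (0, a) = 0)
    (hβ₂ : ∀ d ∈ E₂, ∀ e ∈ E₂, ∀ f ∈ E₂, d < e → e < f → β (1, d) ≠ 0 → β (0, e) = 0) :
    ∃ μ, coeff μ (∏ v, mixedT ℂ E₁ E₂ v ^ β v) ≠ 0 ∧
      ∀ γ : Fin 3 × Fin m →₀ ℕ, grevlexL m γ β →
        coeff μ (∏ v, mixedT ℂ E₁ E₂ v ^ γ v) = 0 := by
  classical
  obtain ⟨f, hf, hfmax⟩ : ∃ f ∈ E₂, ∀ j ∈ E₂, j ≤ f :=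
    ⟨E₂.max' hne, E₂.max'_mem hne, fun j hj => E₂.le_max' j hj⟩
  obtain ⟨μ, hμ, hμe, hμf⟩ := exists_mem_support_mixedT E₁ E₂ hE f β
  refine ⟨μ, mem_support_iff.1 hμ, fun γ hγ => ?_⟩
  by_contra hne'
  have hB := MixedRel.of_mem_support hE β hμ
  have hG := MixedRel.of_mem_support hE γ (mem_support_iff.2 hne')
  have hdeg : monDeg γ = monDeg β := by
    have h1 := hB.deg
    have h2 := hG.deg
    omega
  obtain ⟨⟨i, j⟩, hs, hright⟩ := hγ.exists_of_monDeg_eq hdeg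
  fin_cases i
  · simp only [Fin.zero_eta] at hs hright
    have h1 : ∀ k, γ (1, k) = β (1, k) := fun k => hright (1, k) (Or.inl Fin.zero_lt_one)
    by_cases hj1 : j ∈ E₁
    · refine (Finset.sum_lt_sum (fun k hk => ?_) ⟨j, hj1, hs⟩).ne
        (hB.sum_left.trans hG.sum_left.symm)
      rcases lt_trichotomy k j with h | h | h
      · simp [hβ₁ k hk j hj1 h]
      · exact h ▸ hs.le
      · exact (hright (0, k) (Or.inr ⟨rfl, h⟩)).ge
    by_cases hj2 : j ∈ E₂
    · refine (Finset.sum_lt_sum (fun k hk => ?_) ⟨j, hj2, hs⟩).ne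
        (hB.sum_zero.trans hG.sum_zero.symm)
      by_cases hkf : k = f
      · subst hkf
        rcases (hfmax j hj2).eq_or_lt with h | h
        · exact h ▸ hs.le
        · exact (hright (0, k) (Or.inr ⟨rfl, h⟩)).ge
      · have h2 := hG.le_add k hk
        rw [hμe k hk hkf, h1] at h2
        omega
    · have h2 := hG.free₀ j hj1 hj2
      rw [hB.free₀ j hj1 hj2] at h2
      omega
  · simp only [Fin.mk_one] at hs hright
    by_cases hj : j ∈ E₂
    · by_cases hjf : j = f
      · subst hjf
        have := hG.le j hj
        omega
      · have h1 := hG.le j hj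
        rw [hμe j hj hjf] at h1
        refine (Finset.sum_lt_sum (fun k hk => ?_) ⟨j, hj, hs⟩).ne
          (Nat.add_right_cancel (hB.sum_one.symm.trans hG.sum_one))
        rcases lt_trichotomy k j with h | h | h
        · have h2 : β (1, k) = 0 := by
            by_contra h2
            have := hβ₂ k hk j hj f hf h (lt_of_le_of_ne (hfmax j hj) hjf) h2
            omega
          simp [h2]
        · exact h ▸ hs.le
        · exact (hright (1, k) (Or.inr ⟨rfl, h⟩)).ge
    · have h2 := hG.free₁ j hj
      rw [hB.free₁ j hj] at h2
      omega
  · have h1 := hG.free₂ j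
    rw [hB.free₂] at h1
    simp only [Fin.reduceFinMk] at hs
    omega

end TranslationPart

section Cases
variable {m : ℕ}

theorem identified_of_rename_eq {E₁ E₂ : Finset (Fin m)} {x : Fin 3} {v w : Fin 3 × Fin m}
    (h : (if v.1 = 0 then if v.2 ∈ E₁ then Sum.inr 0 else if v.2 ∈ E₂ then Sum.inr x else Sum.inl v
      else Sum.inl v : (Fin 3 × Fin m) ⊕ Fin 3) =
      if w.1 = 0 then if w.2 ∈ E₁ then Sum.inr 0 else if w.2 ∈ E₂ then Sum.inr x else Sum.inl w
      else Sum.inl w)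
    (hlt : v.1 < w.1 ∨ v.1 = w.1 ∧ v.2 < w.2) :
    v.1 = 0 ∧ v.2 < w.2 ∧ (v.2 ∈ E₁ ∧ w.2 ∈ E₁ ∨ v.2 ∈ E₂ ∧ w.2 ∈ E₂ ∨
      x = 0 ∧ (v.2 ∈ E₁ ∨ v.2 ∈ E₂) ∧ (w.2 ∈ E₁ ∨ w.2 ∈ E₂)) := by
  have hne : v ≠ w := by
    rintro rfl
    rcases hlt with h | ⟨-, h⟩ <;> exact lt_irrefl _ h
  have hlt' : v.1 = 0 → w.1 = 0 → v.2 < w.2 := by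
    intro h1 h2
    rcases hlt with h | ⟨-, h⟩
    · exact absurd h (by simp [h1, h2])
    · exact h
  split_ifs at h with h1 h2 h3 h4 h5 h6 h7 h8 h9 <;>
    simp only [Sum.inl.injEq, Sum.inr.injEq] at h <;>
    first
    | exact absurd h hne
    | (refine ⟨h1, hlt' h1 ‹_›, ?_⟩
       subst_vars
       tauto)

theorem IsLeadMon.fiveDivides (hm : 5 ≤ m) {f : LTRing m}
    {b : (Fin 3 × Fin m) ⊕ (Fin 3 × Fin m) →₀ ℕ} (hb : IsLeadMon (prodOrderLT m) f b)
    (hf : f ∈ ITidealOn m Set.univ) : FiveDivides b := by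
  classical
  by_contra hnot
  set α := projL b with hα
  set β := projT b with hβ
  set E₂ : Finset (Fin m) := {j | After α j ∧ (α (0, j) ≠ 0 ∨ α (1, j) ≠ 0)} with hE₂
  have mem_E₂ : ∀ j, j ∈ E₂ ↔ After α j ∧ (α (0, j) ≠ 0 ∨ α (1, j) ≠ 0) := by simp [hE₂]
  have h321 : ∀ j k, After α j → α (1, j) ≠ 0 → j < k → α (0, k) = 0 := by
    rintro j k ⟨a, ha, ha'⟩ hj hjk
    by_contra hk
    exact hnot (fiveDivides_three_two_one hm ha hjk ha' hj hk)
  have hadm : ∀ E₁ : Finset (Fin m), (∀ j ∈ E₁, ¬ After α j) → IsAdmissible α E₁ E₂ :=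
    fun E₁ h => ⟨fun j hj => ((mem_E₂ j).1 hj).1, fun j h1 h2 => (mem_E₂ j).2 ⟨h1, h2⟩, h, h321⟩
  set E₁ : Finset (Fin m) := {j | α (0, j) ≠ 0 ∧ ¬ After α j ∧ ∃ a < j, α (1, a) ≠ 0} with hE₁
  have mem_E₁ : ∀ j, j ∈ E₁ ↔ α (0, j) ≠ 0 ∧ ¬ After α j ∧ ∃ a < j, α (1, a) ≠ 0 := by
    simp [hE₁]
  have hE₁' : ∀ j, ¬ After α j → α (0, j) ≠ 0 → j ∈ E₁ ∨ ∀ k < j, α (1, k) = 0 := by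
    intro j h1 h2
    by_cases h : ∃ a < j, α (1, a) ≠ 0
    · exact Or.inl ((mem_E₁ j).2 ⟨h2, h1, h⟩)
    · push Not at h
      exact Or.inr h
  have h211 : ∀ j ∈ E₁, ∀ k, j < k → α (0, k) ≠ 0 → β (0, j) = 0 := by
    intro j hj k hjk hk
    obtain ⟨h1, -, a, ha, ha'⟩ := (mem_E₁ j).1 hj
    by_contra h
    exact hnot (fiveDivides_two_one_one hm ha hjk ha' h1 hk h)
  by_cases hII : ∃ j, After α j ∧ α (0, j) ≠ 0
  · obtain ⟨j₀, hj₀, hj₀'⟩ := hII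
    have key : ∀ j k, j < k → (j ∈ E₁ ∨ j ∈ E₂) → (k ∈ E₁ ∨ k ∈ E₂) → β (0, j) = 0 := by
      intro j k hjk hj hk
      rcases hj with hj | hj
      · refine h211 j hj j₀ (lt_of_not_ge fun h => ?_) hj₀'
        exact ((mem_E₁ j).1 hj).2.1 (hj₀.mono h)
      · obtain ⟨hA, hj'⟩ := (mem_E₂ j).1 hj
        obtain ⟨a, ha, ha'⟩ := id hA
        have hk' : α (0, k) ≠ 0 ∨ α (1, k) ≠ 0 := by
          rcases hk with hk | hk
          · exact Or.inl ((mem_E₁ k).1 hk).1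
          · exact ((mem_E₂ k).1 hk).2
        by_contra h
        by_cases hj0 : α (0, j) = 0
        · have hj1 := hj'.resolve_left (not_not.2 hj0)
          have hk1 := hk'.resolve_left (not_not.2 (h321 j k hA hj1 hjk))
          have hlt : j₀ < j := by
            rcases lt_trichotomy j₀ j with h | h | h
            · exact h
            · exact absurd (h ▸ hj0) hj₀'
            · exact absurd (h321 j j₀ hA hj1 h) hj₀'
          obtain ⟨c, hc, hc'⟩ := hj₀
          exact hnot (fiveDivides_three_one_two_two hm hc hlt hjk hc' hj₀' hj1 hk1 h)
        · rcases hk' with hk' | hk'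
          · exact hnot (fiveDivides_three_one_one hm ha hjk ha' hj0 hk' h)
          · exact hnot (fiveDivides_three_one_two hm ha hjk ha' hj0 hk' h)
    refine hb.false_of_degeneration_joint hf (hadm E₁ fun j hj => ((mem_E₁ j).1 hj).2.1) hE₁' _
      (fun v => rfl) fun γ hγ => mapDomain_ne_of_grevlexL hγ ?_
    rintro ⟨i, j⟩ ⟨i', k⟩ h hlt
    obtain ⟨rfl, hjk, h⟩ := identified_of_rename_eq h hlt
    rcases h with ⟨h1, h2⟩ | ⟨h1, h2⟩ | ⟨-, h1, h2⟩
    · exact key j k hjk (Or.inl h1) (Or.inl h2)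
    · exact key j k hjk (Or.inr h1) (Or.inr h2)
    · exact key j k hjk h1 h2
  push Not at hII
  by_cases hB : ∃ d e, d < e ∧ After α d ∧ α (1, d) ≠ 0 ∧ α (1, e) ≠ 0 ∧ β (0, d) ≠ 0
  · obtain ⟨d, e, hde, ⟨c, hcd, hc⟩, hd, he, hd'⟩ := hB
    set E₃ : Finset (Fin m) := {j | α (0, j) ≠ 0 ∧ ¬ After α j} with hE₃
    have mem_E₃ : ∀ j, j ∈ E₃ ↔ α (0, j) ≠ 0 ∧ ¬ After α j := by simp [hE₃]
    have hE₂' : ∀ j ∈ E₂, After α j ∧ α (1, j) ≠ 0 := fun j hj =>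
      ⟨((mem_E₂ j).1 hj).1, ((mem_E₂ j).1 hj).2.resolve_left
        (not_not.2 (hII j ((mem_E₂ j).1 hj).1))⟩
    obtain ⟨μ, hμ, hμ'⟩ := exists_coeff_prod_mixedT_ne_zero (E₁ := E₃) (E₂ := E₂) (β := β)
      (Finset.disjoint_left.2 fun j h1 h2 => ((mem_E₃ j).1 h1).2 ((mem_E₂ j).1 h2).1)
      ⟨d, (mem_E₂ d).2 ⟨⟨c, hcd, hc⟩, Or.inr hd⟩⟩ (by
        intro a ha k hk hak
        by_contra h
        refine hnot (fiveDivides_one_one_three_two_two hm hak (not_lt.1 fun h => ?_) hcd hde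
          ((mem_E₃ a).1 ha).1 ((mem_E₃ k).1 hk).1 hc hd he h hd')
        exact ((mem_E₃ k).1 hk).2 ⟨c, h, hc⟩) (by
        intro x hx y hy z hz hxy hyz hx'
        by_contra h
        obtain ⟨⟨a, ha, ha'⟩, hx1⟩ := hE₂' x hx
        exact hnot (fiveDivides_three_two_two_two hm ha hxy hyz ha' hx1 (hE₂' y hy).2
          (hE₂' z hz).2 hx' h))
    exact hb.false_of_degeneration_mixed hf (hadm E₃ fun j hj => ((mem_E₃ j).1 hj).2) hII
      (fun j h1 h2 => (mem_E₃ j).2 ⟨h2, h1⟩) (mixedT ℂ E₃ E₂) (fun v => rfl) μ hμ hμ'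
  · push Not at hB
    refine hb.false_of_degeneration_separate hf (hadm E₁ fun j hj => ((mem_E₁ j).1 hj).2.1) hII
      hE₁' _ (fun v => rfl) fun γ hγ => mapDomain_ne_of_grevlexL hγ ?_
    have key₂ : ∀ j ∈ E₂, ∀ k ∈ E₂, j < k → β (0, j) = 0 := by
      intro j hj k hk hjk
      obtain ⟨h1, h2⟩ := (mem_E₂ j).1 hj
      obtain ⟨h3, h4⟩ := (mem_E₂ k).1 hk
      exact hB j k hjk h1 (h2.resolve_left (not_not.2 (hII j h1)))
        (h4.resolve_left (not_not.2 (hII k h3)))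
    rintro ⟨i, j⟩ ⟨i', k⟩ h hlt
    obtain ⟨rfl, hjk, h⟩ := identified_of_rename_eq h hlt
    rcases h with ⟨h1, h2⟩ | ⟨h1, h2⟩ | ⟨h, -⟩
    · exact h211 j h1 k hjk ((mem_E₁ k).1 h2).1
    · exact key₂ j h1 k h2 hjk
    · exact absurd h one_ne_zero

end Cases

/-- **Theorem 3.4.** For every `m ≥ 5`, the reduced Gröbner basis `G_m` of the
indeterminate translation ideal `I_{𝒞(t)}` with respect to the product monomial order
equals the union, over all 5-element subsets `σ ⊆ [m]`, of the reduced Gröbner bases of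
the IT ideals of the cameras indexed by `σ`. -/
theorem reducedGB_ITideal_eq_union_five {m : ℕ} (hm : 5 ≤ m)
    (G : Set (LTRing m))
    (hG : IsReducedGB (prodOrderLT m) (ITidealOn m Set.univ) G)
    (𝒢 : Finset (Fin m) → Set (LTRing m))
    (h𝒢 : ∀ σ : Finset (Fin m), σ.card = 5 →
      IsReducedGB (prodOrderLT m) (ITidealOn m ↑σ) (𝒢 σ)) :
    G = ⋃ (σ : Finset (Fin m)) (_ : σ.card = 5), 𝒢 σ := by
  exact reducedGB_eq_iUnion_of_exists_le (fun _ hf _ hb => hb.fiveDivides hm hf) G hG 𝒢 h𝒢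

end
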